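/- Let Ω ⊆ ℂ be a bounded domain such that the connected components of ∂Ω containing more than one point form a countable family {P_n} with Σ_n diam(P_n) < ∞, and such that the union of all singleton connected components of ∂Ω (that is, ∂Ω \ ⋃_n P_n) has σ-finite linear measure. Let D be a circle domain and let φ : D → Ω be a conformal homeomorphism. Then φ admits a continuous extension φ̄ : closure(D) → closure(Ω) if and only if ∂Ω is a Peano compactum. -/

import Mathlib

open Set Metric Filter MeasureTheory Topology

noncomputable section

/-- A planar domain: a nonempty open connected subset of ℂ. -/
def IsPlanarDomain (D : Set ℂ) : Prop := D.Nonempty ∧ IsOpen D ∧ IsConnected D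

/-- A Peano compactum: a compact subset of ℂ all of whose connected components are
locally connected (as subspaces of ℂ) and such that for every `C > 0` only finitely
many components have diameter greater than `C`. -/
def IsPeanoCompactum (K : Set ℂ) : Prop :=
  IsCompact K ∧
  (∀ x ∈ K, LocallyConnectedSpace ↥(connectedComponentIn K x)) ∧
  ∀ C : ℝ, 0 < C →
    {Q : Set ℂ | (∃ x ∈ K, Q = connectedComponentIn K x) ∧ C < Metric.diam Q}.Finite

/-- A Jordan curve: a subset of ℂ homeomorphic to the unit circle. -/
def IsJordanCurve (J : Set ℂ) : Prop :=
  Nonempty (↥J ≃ₜ ↥(Metric.sphere (0:ℂ) 1))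

/-- A generalized Jordan domain: a bounded domain whose boundary is a Peano compactum,
each of whose boundary components is a single point or a Jordan curve. -/
def IsGeneralizedJordanDomain (D : Set ℂ) : Prop :=
  IsPlanarDomain D ∧ Bornology.IsBounded D ∧
  IsPeanoCompactum (frontier D) ∧
  ∀ x ∈ frontier D,
    connectedComponentIn (frontier D) x = {x} ∨
    IsJordanCurve (connectedComponentIn (frontier D) x)

/-- `φ` restricts to a homeomorphism of `D` onto `Ω`. -/
def IsHomeoOnto (φ : ℂ → ℂ) (D Ω : Set ℂ) : Prop :=
  ContinuousOn φ D ∧ Set.BijOn φ D Ω ∧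
  ∃ ψ : ℂ → ℂ, ContinuousOn ψ Ω ∧ Set.InvOn ψ φ D Ω

/-- `φ` is a conformal homeomorphism (holomorphic bijection) of `D` onto `Ω`. -/
def IsConformalHomeoOnto (φ : ℂ → ℂ) (D Ω : Set ℂ) : Prop :=
  DifferentiableOn ℂ φ D ∧ Set.BijOn φ D Ω

/-- `φb` is a continuous extension of `φ : D → Ω` to `closure D`, with values in `closure Ω`. -/
def ExtendsContinuously (φ φb : ℂ → ℂ) (D Ω : Set ℂ) : Prop :=
  ContinuousOn φb (closure D) ∧ Set.EqOn φb φ D ∧ Set.MapsTo φb (closure D) (closure Ω)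

/-- The oscDiam `σ_r(z₀) = diam φ(D ∩ C_r(z₀))`. -/
def oscDiam (φ : ℂ → ℂ) (D : Set ℂ) (z₀ : ℂ) (r : ℝ) : ℝ :=
  Metric.diam (φ '' (D ∩ Metric.sphere z₀ r))

/-- `liminf_{r→0⁺} σ_r(z₀) = 0`. -/
def OscLiminfZero (φ : ℂ → ℂ) (D : Set ℂ) (z₀ : ℂ) : Prop :=
  Filter.liminf (oscDiam φ D z₀) (nhdsWithin (0:ℝ) (Set.Ioi 0)) = 0

/-- A circle domain (normalized so that ∞ lies in a complementary disk): every bounded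
complementary component is a point or a closed round disk, and the unbounded
complementary component is the complement of an open round disk. -/
def IsCircleDomain (D : Set ℂ) : Prop :=
  IsPlanarDomain D ∧ Bornology.IsBounded D ∧
  ∀ x ∈ Dᶜ,
    (Bornology.IsBounded (connectedComponentIn Dᶜ x) →
      connectedComponentIn Dᶜ x = {x} ∨
      ∃ c : ℂ, ∃ rad : ℝ, 0 < rad ∧ connectedComponentIn Dᶜ x = Metric.closedBall c rad) ∧
    (¬ Bornology.IsBounded (connectedComponentIn Dᶜ x) →
      ∃ c : ℂ, ∃ rad : ℝ, 0 < rad ∧ connectedComponentIn Dᶜ x = (Metric.ball c rad)ᶜ)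

/-- A set has σ-finite linear (1-dimensional Hausdorff) measure. -/
def SigmaFiniteH1 (E : Set ℂ) : Prop :=
  ∃ f : ℕ → Set ℂ, (⋃ n, f n) = E ∧ ∀ n, μH[1] (f n) < ⊤

/-- The set of connected components of `K` containing more than one point. -/
def NondegComponents (K : Set ℂ) : Set (Set ℂ) :=
  {Q | (∃ x ∈ K, Q = connectedComponentIn K x) ∧ ∃ a ∈ Q, ∃ b ∈ Q, a ≠ b}

/-- The union of the singleton connected components of `K`. -/
def SingletonPart (K : Set ℂ) : Set ℂ :=
  {x | x ∈ K ∧ connectedComponentIn K x = {x}}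

/-- The cluster set `C(h, z₀) = ⋂_{r>0} closure h({z ∈ U : |z − z₀| < r})`. -/
def clusterSet (h : ℂ → ℂ) (U : Set ℂ) (z₀ : ℂ) : Set ℂ :=
  ⋂ r ∈ Set.Ioi (0:ℝ), closure (h '' (U ∩ Metric.ball z₀ r))

/-- The boundary component of `Ω` corresponding (under `φ : D → Ω`) to a boundary
component `Q` of `D`: `φ^B(Q) = ⋃_{z ∈ Q} C(φ, z)`. -/
def boundaryComp (φ : ℂ → ℂ) (D : Set ℂ) (Q : Set ℂ) : Set ℂ :=
  ⋃ z ∈ Q, clusterSet φ D z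

/-- An arc: the image of a continuous injective map from `[0,1]`. -/
def IsArc (A : Set ℂ) : Prop :=
  ∃ f : ℝ → ℂ, ContinuousOn f (Set.Icc 0 1) ∧ Set.InjOn f (Set.Icc 0 1) ∧
    f '' Set.Icc 0 1 = A

/-- An arc from `a` to `b`. -/
def IsArcFromTo (A : Set ℂ) (a b : ℂ) : Prop :=
  ∃ f : ℝ → ℂ, ContinuousOn f (Set.Icc 0 1) ∧ Set.InjOn f (Set.Icc 0 1) ∧
    f '' Set.Icc 0 1 = A ∧ f 0 = a ∧ f 1 = b

/-- Property S: for every `ε > 0`, `Ω` is a finite union of connected sets of diameter `< ε`. -/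
def PropertyS (Ω : Set ℂ) : Prop :=
  ∀ ε > (0:ℝ), ∃ (k : ℕ) (N : Fin k → Set ℂ),
    (∀ i, IsConnected (N i) ∧ Metric.diam (N i) < ε) ∧ (⋃ i, N i) = Ω

/-- `x ∈ ∂Ω` is locally accessible from `Ω`. -/
def LocallyAccessible (Ω : Set ℂ) (x : ℂ) : Prop :=
  ∀ ε > (0:ℝ), ∃ δ > (0:ℝ), ∀ z ∈ Ω, dist z x < δ →
    ∃ A : Set ℂ, IsArcFromTo A z x ∧ A ⊆ Ω ∪ {x} ∧ Metric.diam A < ε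

/-- `ξ ∈ ∂Ω` is locally sequentially accessible. -/
def LocallySeqAccessible (Ω : Set ℂ) (ξ : ℂ) : Prop :=
  ∀ r > (0:ℝ), ∀ ξn : ℕ → ℂ, (∀ n, ξn n ∈ Ω) → Filter.Tendsto ξn Filter.atTop (nhds ξ) →
    ∃ x ∈ Ω ∩ Metric.ball ξ r,
      {n : ℕ | ξn n ∈ connectedComponentIn (Ω ∩ Metric.ball ξ r) x}.Infinite

/-- `Ω` is finitely connected at the boundary point `x`. -/
def FinitelyConnectedAt (Ω : Set ℂ) (x : ℂ) : Prop :=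
  ∀ r > (0:ℝ), ∃ U : Set ℂ, IsOpen U ∧ x ∈ U ∧ U ⊆ Metric.ball x r ∧
    {Q : Set ℂ | ∃ y ∈ U ∩ Ω, Q = connectedComponentIn (U ∩ Ω) y}.Finite

/-- The diameter (Mazurkiewicz) distance on `Ω`. -/
def mazDist (Ω : Set ℂ) (x y : ℂ) : ℝ :=
  sInf (Metric.diam '' {E : Set ℂ | E ⊆ Ω ∧ IsConnected E ∧ x ∈ E ∧ y ∈ E})

/-- `Ω` is totally bounded for the Mazurkiewicz distance; for a metric space this is
equivalent to compactness of the metric completion of `(Ω, mazDist)`. -/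
def MazCompletionCompact (Ω : Set ℂ) : Prop :=
  ∀ ε > (0:ℝ), ∃ F : Finset ℂ, ↑F ⊆ Ω ∧ ∀ x ∈ Ω, ∃ y ∈ F, mazDist Ω x y < ε

/-- `f : A → B` is non-alternating: there are no `x, y ∈ B` and no separation of
`A \ f⁻¹({x})` into two disjoint nonempty relatively open sets `A₁, A₂` with
`y ∈ f(A₁) ∩ f(A₂)`. -/
def NonAlternatingOn (f : ℂ → ℂ) (A B : Set ℂ) : Prop :=
  ¬ ∃ x ∈ B, ∃ y ∈ B, ∃ A₁ A₂ : Set ℂ,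
      A₁.Nonempty ∧ A₂.Nonempty ∧ Disjoint A₁ A₂ ∧
      A₁ ∪ A₂ = {z | z ∈ A ∧ f z ≠ x} ∧
      (∃ U₁ : Set ℂ, IsOpen U₁ ∧ A₁ = U₁ ∩ {z | z ∈ A ∧ f z ≠ x}) ∧
      (∃ U₂ : Set ℂ, IsOpen U₂ ∧ A₂ = U₂ ∩ {z | z ∈ A ∧ f z ≠ x}) ∧
      y ∈ f '' A₁ ∧ y ∈ f '' A₂

/-- Homotopies of nonvanishing functions starting at the constant `1` admit a logarithm. -/
theorem exists_log_homotopy {X : Type*} [TopologicalSpace X] (G : unitInterval × X → ℂ)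
    (hG : Continuous G) (hne : ∀ p, G p ≠ 0) (h0 : ∀ x, G (0, x) = 1) :
    ∃ L : unitInterval × X → ℂ, Continuous L ∧ (∀ p, Complex.exp (L p) = G p) ∧
      ∀ x, L (0, x) = 0 := by
  let H : C(unitInterval × X, {z : ℂ // z ≠ 0}) := ⟨fun p => ⟨G p, hne p⟩, by fun_prop⟩
  let f : C(X, ℂ) := ⟨fun _ => 0, continuous_const⟩
  have H_0 : ∀ x, H (0, x) = (fun z : ℂ ↦ (⟨_, z.exp_ne_zero⟩ : {z : ℂ // z ≠ 0})) (f x) := by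
    intro x
    apply Subtype.ext
    simp [H, f, h0]
  refine ⟨Complex.isCoveringMap_exp.liftHomotopy H f H_0, ContinuousMap.continuous _, ?_, ?_⟩
  · intro p
    have := congrFun (Complex.isCoveringMap_exp.liftHomotopy_lifts H f H_0) p
    exact congrArg Subtype.val this
  · intro x
    exact Complex.isCoveringMap_exp.liftHomotopy_zero H f H_0 x

theorem eq_of_exp_eq {A : Type*} [TopologicalSpace A] [PreconnectedSpace A] {f g : A → ℂ}
    (hf : Continuous f) (hg : Continuous g) (h : ∀ a, Complex.exp (f a) = Complex.exp (g a))
    (a : A) (ha : f a = g a) (b : A) : f b = g b := by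
  refine congrFun (Complex.isCoveringMap_exp.eq_of_comp_eq hf hg ?_ a ha) b
  funext a
  exact Subtype.ext (h a)

theorem exists_log_of_continuous {N : ℂ → ℂ} (hN : Continuous N) (h0 : ∀ z, N z ≠ 0) :
    ∃ L : ℂ → ℂ, Continuous L ∧ ∀ z, Complex.exp (L z) = N z := by
  obtain ⟨G, ⟨-, hG⟩, -⟩ := Complex.isCoveringMapOn_exp.existsUnique_continuousMap_lifts
    (⟨N, hN⟩ : C(ℂ, ℂ)) (Complex.exp_log (h0 0)) (fun x => h0 x)
  exact ⟨G, G.continuous, fun z => congrFun hG z⟩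

/-- On the boundary of a bounded set containing `z` but whose closure misses `z'`, the
function `(ξ - z) / (ξ - z')` has no continuous logarithm. -/
theorem not_exists_log_frontier {G : Set ℂ} (hGb : Bornology.IsBounded G)
    {z z' : ℂ} (hz : z ∈ G) (hz' : z' ∉ closure G) {L : ℂ → ℂ} (hL : ContinuousOn L (frontier G))
    (hexp : ∀ ξ ∈ frontier G, Complex.exp (L ξ) = (ξ - z) / (ξ - z')) : False := by
  obtain ⟨T, hT⟩ : ∃ T : C(ℂ, ℂ), ∀ ξ ∈ frontier G, T ξ = L ξ := by
    obtain ⟨T, hT⟩ := ContinuousMap.exists_restrict_eq (isClosed_frontier (s := G))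
      (⟨(frontier G).domRestrict L, continuousOn_iff_continuous_domRestrict.mp hL⟩ :
        C(frontier G, ℂ))
    exact ⟨T, fun ξ hξ => congrArg (fun f => f ⟨ξ, hξ⟩) hT⟩
  have hfr : frontier G ⊆ closure G := frontier_subset_closure
  classical
  let N : ℂ → ℂ := fun ξ => if ξ ∈ closure G then (ξ - z') * Complex.exp (T ξ) else ξ - z
  have hN : Continuous N := by
    apply Continuous.if
    · intro a ha
      have ha' : a ∈ frontier G := by
        have : a ∈ frontier (closure G) := ha
        exact frontier_closure_subset this
      rw [hT a ha', hexp a ha', mul_div_cancel₀]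
      intro h
      exact hz' (sub_eq_zero.1 h ▸ hfr ha')
    · fun_prop
    · fun_prop
  have hN0 : ∀ ξ, N ξ ≠ 0 := by
    intro ξ
    by_cases h : ξ ∈ closure G
    · simp only [N, h, if_true]
      refine mul_ne_zero (fun h' => hz' (sub_eq_zero.1 h' ▸ h)) (Complex.exp_ne_zero _)
    · simp only [N, h, if_false]
      exact fun h' => h (sub_eq_zero.1 h' ▸ subset_closure hz)
  obtain ⟨l, hl, hle⟩ := exists_log_of_continuous hN hN0
  obtain ⟨R, hR⟩ := hGb.closure.subset_ball z
  have hRpos : 0 < R := by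
    have := hR (subset_closure hz)
    simpa using this
  have key : ∀ θ : ℝ, Complex.exp (l (circleMap z R θ)) = R * Complex.exp (θ * Complex.I) := by
    intro θ
    rw [hle]
    have : circleMap z R θ ∉ closure G := by
      intro h
      have := hR h
      rw [mem_ball, dist_eq_norm] at this
      simp [circleMap, abs_of_pos hRpos] at this
    simp only [N, this, if_false]
    simp [circleMap]
  have h1 := eq_of_exp_eq (A := ℝ) (f := fun θ => l (circleMap z R θ))
    (g := fun θ : ℝ => l (circleMap z R 0) + θ * Complex.I)
    (hl.comp (continuous_circleMap z R)) (by fun_prop) (by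
      intro θ
      rw [Complex.exp_add, key, key]
      simp) 0 (by simp) (2 * Real.pi)
  have h2 : circleMap z R (2 * Real.pi) = circleMap z R 0 := by
    simpa using (periodic_circleMap z R) 0
  simp only [h2] at h1
  have h3 : ((2 * Real.pi : ℝ) : ℂ) * Complex.I = 0 := by
    have := h1
    simpa using this.symm
  simp [Real.pi_ne_zero] at h3

theorem isOpen_image_of_injOn {D U : Set ℂ} {φ : ℂ → ℂ} (hDo : IsOpen D)
    (hd : DifferentiableOn ℂ φ D) (hi : InjOn φ D) (hU : IsOpen U) (hUD : U ⊆ D) :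
    IsOpen (φ '' U) := by
  rw [isOpen_iff_mem_nhds]
  rintro _ ⟨z, hz, rfl⟩
  have ha : AnalyticAt ℂ φ z := hd.analyticAt (hDo.mem_nhds (hUD hz))
  rcases ha.eventually_constant_or_nhds_le_map_nhds with h | h
  · exfalso
    have h1 : ∀ᶠ x in 𝓝[≠] z, x ∈ D ∧ φ x = φ z :=
      ((hDo.eventually_mem (hUD hz)).and h).filter_mono nhdsWithin_le_nhds
    obtain ⟨x, ⟨hxD, hx⟩, hne⟩ := (h1.and self_mem_nhdsWithin).exists
    exact hne (hi hxD (hUD hz) hx)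
  · exact h (image_mem_map (hU.mem_nhds hz))

theorem IsConformalHomeoOnto.exists_inverse {D Ω : Set ℂ} {φ : ℂ → ℂ} (hDo : IsOpen D)
    (hφ : IsConformalHomeoOnto φ D Ω) :
    ∃ ψ : ℂ → ℂ, IsConformalHomeoOnto ψ Ω D ∧ InvOn ψ φ D Ω := by
  obtain ⟨hd, hb⟩ := hφ
  have hinv : InvOn (Function.invFunOn φ D) φ D Ω := hb.invOn_invFunOn
  set ψ := Function.invFunOn φ D with hψ
  have hmaps : MapsTo ψ Ω D := hb.surjOn.mapsTo_invFunOn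
  have hΩo : IsOpen Ω := by
    rw [← hb.image_eq]
    exact isOpen_image_of_injOn hDo hd hb.injOn hDo subset_rfl
  have hcont : ∀ w ∈ Ω, ContinuousAt ψ w := by
    intro w hw U hU
    obtain ⟨V, hVU, hVo, hV⟩ := _root_.mem_nhds_iff.1 hU
    have h1 : IsOpen (φ '' (V ∩ D)) :=
      isOpen_image_of_injOn hDo hd hb.injOn (hVo.inter hDo) inter_subset_right
    rw [mem_map]
    refine mem_of_superset (h1.mem_nhds ⟨ψ w, ⟨hV, hmaps hw⟩, hinv.2 hw⟩) ?_
    rintro _ ⟨x, ⟨hxV, hxD⟩, rfl⟩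
    change ψ (φ x) ∈ U
    rw [hinv.1 hxD]
    exact hVU hxV
  have hgood : ∀ w ∈ Ω, deriv φ (ψ w) ≠ 0 → DifferentiableAt ℂ ψ w := by
    intro w hw hne
    have h1 : HasDerivAt φ (deriv φ (ψ w)) (ψ w) :=
      (hd.differentiableAt (hDo.mem_nhds (hmaps hw))).hasDerivAt
    refine (HasDerivAt.of_local_left_inverse (hcont w hw) h1 hne ?_).differentiableAt
    filter_upwards [hΩo.mem_nhds hw] with x hx using hinv.2 hx
  refine ⟨ψ, ⟨fun w hw => DifferentiableAt.differentiableWithinAt ?_, hinv.symm.bijOn hmaps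
    hb.mapsTo⟩, hinv⟩
  have ha : AnalyticAt ℂ (deriv φ) (ψ w) := (hd.analyticAt (hDo.mem_nhds (hmaps hw))).deriv
  rcases ha.eventually_eq_zero_or_eventually_ne_zero with h | h
  · exfalso
    obtain ⟨r, hr, hball⟩ := Metric.eventually_nhds_iff_ball.1
      (h.and (hDo.eventually_mem (hmaps hw)))
    have hx : ψ w + (r / 2 : ℝ) ∈ ball (ψ w) r := by
      simp [abs_of_pos hr, hr]
    have := (convex_ball (ψ w) r).is_const_of_fderivWithin_eq_zero (𝕜 := ℂ) (f := φ)
      (fun x hx => (hd.differentiableAt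
        (hDo.mem_nhds (hball x hx).2)).differentiableWithinAt) (by
        intro x hx
        rw [fderivWithin_of_isOpen isOpen_ball hx]
        ext
        simpa using (hball x hx).1) hx (mem_ball_self hr)
    have h2 := hb.injOn (hball _ hx).2 (hmaps hw) this
    simp [hr.ne'] at h2
  · apply AnalyticAt.differentiableAt
    refine Complex.analyticAt_of_differentiable_on_punctured_nhds_of_continuousAt ?_ (hcont w hw)
    have h1 : Tendsto ψ (𝓝[≠] w) (𝓝[≠] (ψ w)) := by
      refine tendsto_nhdsWithin_of_tendsto_nhds_of_eventually_within _
        ((hcont w hw).tendsto.mono_left nhdsWithin_le_nhds) ?_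
      filter_upwards [self_mem_nhdsWithin, nhdsWithin_le_nhds (hΩo.mem_nhds hw)] with x hx hxΩ h'
      apply hx
      have := congrArg φ h'
      rwa [hinv.2 hxΩ, hinv.2 hw] at this
    filter_upwards [h1.eventually h, nhdsWithin_le_nhds (hΩo.mem_nhds hw)] with x hx hxΩ
    exact hgood x hxΩ hx

theorem IsConformalHomeoOnto.deriv_ne_zero {D Ω : Set ℂ} {φ : ℂ → ℂ} (hDo : IsOpen D)
    (hΩo : IsOpen Ω) (hφ : IsConformalHomeoOnto φ D Ω) {z : ℂ} (hz : z ∈ D) :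
    deriv φ z ≠ 0 := by
  obtain ⟨ψ, hψ, hinv⟩ := hφ.exists_inverse hDo
  intro h0
  have h1 : HasDerivAt φ (deriv φ z) z :=
    (hφ.1.differentiableAt (hDo.mem_nhds hz)).hasDerivAt
  have h2 : HasDerivAt ψ (deriv ψ (φ z)) (φ z) :=
    (hψ.1.differentiableAt (hΩo.mem_nhds (hφ.2.mapsTo hz))).hasDerivAt
  have h3 := h2.comp z h1
  have h4 : HasDerivAt (ψ ∘ φ) 1 z := by
    refine (hasDerivAt_id z).congr_of_eventuallyEq ?_
    filter_upwards [hDo.mem_nhds hz] with x hx using hinv.1 hx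
  have := h3.unique h4
  simp [h0] at this

theorem continuousOn_dslope_prod {D : Set ℂ} {φ : ℂ → ℂ} (hDo : IsOpen D)
    (hd : DifferentiableOn ℂ φ D) :
    ContinuousOn (fun p : ℂ × ℂ => dslope φ p.2 p.1) (D ×ˢ D) := by
  rintro ⟨a, b⟩ ⟨ha, hb⟩
  simp only at ha hb
  apply ContinuousAt.continuousWithinAt
  by_cases hab : a = b
  · subst hab
    have han : AnalyticAt ℂ φ a := hd.analyticAt (hDo.mem_nhds ha)
    have hst : HasStrictDerivAt φ (deriv φ a) a := han.hasStrictDerivAt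
    have hst' := hasStrictDerivAt_iff_hasStrictFDerivAt.1 hst
    have hlo := hst'.isLittleO
    have hdc : ContinuousAt (deriv φ) a := han.deriv.continuousAt
    rw [ContinuousAt, Metric.tendsto_nhds]
    intro ε hε
    have h1 := (hlo.bound (half_pos hε))
    have h2 : ∀ᶠ p : ℂ × ℂ in 𝓝 (a, a), dist (deriv φ p.2) (deriv φ a) < ε :=
      (continuousAt_snd (p := (a, a))).eventually (Metric.tendsto_nhds.1 hdc ε hε)
    filter_upwards [h1, h2] with p hp hp2
    by_cases hpe : p.1 = p.2
    · simp only [hpe, dslope_same]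
      exact hp2
    · rw [dslope_of_ne _ hpe, dslope_same, dist_eq_norm]
      have hne : p.1 - p.2 ≠ 0 := sub_ne_zero.2 hpe
      have hpos : 0 < ‖p.1 - p.2‖ := norm_pos_iff.2 hne
      have : slope φ p.2 p.1 - deriv φ a =
          (φ p.1 - φ p.2 - (p.1 - p.2) * deriv φ a) / (p.1 - p.2) := by
        rw [slope_def_field]
        field_simp
      rw [this, norm_div, div_lt_iff₀ hpos]
      have h3 : ‖φ p.1 - φ p.2 - (p.1 - p.2) * deriv φ a‖ ≤ ε / 2 * ‖p.1 - p.2‖ := by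
        simpa using hp
      nlinarith
  · have hev : (fun p : ℂ × ℂ => dslope φ p.2 p.1) =ᶠ[𝓝 (a, b)]
        fun p => (φ p.1 - φ p.2) / (p.1 - p.2) := by
      have : ∀ᶠ p : ℂ × ℂ in 𝓝 (a, b), p.1 ≠ p.2 :=
        (isOpen_ne_fun continuous_fst continuous_snd).mem_nhds hab
      filter_upwards [this] with p hp
      rw [dslope_of_ne _ hp, slope_def_field]
    refine ContinuousAt.congr ?_ hev.symm
    have c1 : ContinuousAt φ a := (hd.differentiableAt (hDo.mem_nhds ha)).continuousAt
    have c2 : ContinuousAt φ b := (hd.differentiableAt (hDo.mem_nhds hb)).continuousAt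
    have c1' : ContinuousAt (fun p : ℂ × ℂ => φ p.1) (a, b) :=
      ContinuousAt.comp (f := Prod.fst) c1 continuousAt_fst
    have c2' : ContinuousAt (fun p : ℂ × ℂ => φ p.2) (a, b) :=
      ContinuousAt.comp (f := Prod.snd) c2 continuousAt_snd
    exact (c1'.sub c2').div (by fun_prop) (sub_ne_zero.2 hab)

theorem IsConformalHomeoOnto.dslope_ne_zero {D Ω : Set ℂ} {φ : ℂ → ℂ} (hDo : IsOpen D)
    (hΩo : IsOpen Ω) (hφ : IsConformalHomeoOnto φ D Ω) {a b : ℂ} (ha : a ∈ D) (hb : b ∈ D) :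
    dslope φ b a ≠ 0 := by
  by_cases hab : a = b
  · subst hab
    rw [dslope_same]
    exact hφ.deriv_ne_zero hDo hΩo ha
  · rw [dslope_of_ne _ hab, slope_def_field]
    exact div_ne_zero (sub_ne_zero.2 fun h => hab (hφ.2.injOn ha hb h)) (sub_ne_zero.2 hab)

/-- For two points `z, z'` of `D`, the quotients `(ξ - z) / (ξ - z')` and
`(ζ - φ z) / (ζ - φ z')` have logarithms `l`, `h` off a compact subset of `D`, resp. `Ω`,
which differ, through `φ`, by a continuous function `q` on all of `D`. -/
theorem IsConformalHomeoOnto.exists_logs {D Ω : Set ℂ} {φ : ℂ → ℂ} (hD : IsPlanarDomain D)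
    (hΩo : IsOpen Ω) (hφ : IsConformalHomeoOnto φ D Ω) {z z' : ℂ} (hz : z ∈ D) (hz' : z' ∈ D) :
    ∃ (K : Set ℂ) (l h q : ℂ → ℂ), IsCompact K ∧ K ⊆ D ∧ z ∈ K ∧ z' ∈ K ∧
      ContinuousOn l Kᶜ ∧ ContinuousOn h (φ '' K)ᶜ ∧ ContinuousOn q D ∧
      (∀ ξ ∈ Kᶜ, Complex.exp (l ξ) = (ξ - z) / (ξ - z')) ∧
      (∀ ζ ∈ (φ '' K)ᶜ, Complex.exp (h ζ) = (ζ - φ z) / (ζ - φ z')) ∧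
      (∀ ξ ∈ D, ξ ≠ z → ξ ≠ z' →
        Complex.exp (q ξ) * ((ξ - z) / (ξ - z')) = (φ ξ - φ z) / (φ ξ - φ z')) ∧
      ∀ ξ ∈ D \ K, h (φ ξ) = q ξ + l ξ := by
  obtain ⟨hne, hDo, hDc⟩ := hD
  have hpc : IsPathConnected D := hDo.isConnected_iff_isPathConnected.1 hDc
  obtain ⟨γ, hγ⟩ := hpc.joinedIn z' hz' z hz
  have hφc : ContinuousOn φ D := hφ.1.continuousOn
  have hφγ : Continuous fun t => φ (γ t) := hφc.comp_continuous γ.continuous hγ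
  set K := range γ with hK
  have hKD : K ⊆ D := by rintro _ ⟨t, rfl⟩; exact hγ t
  have hKc : IsCompact K := isCompact_range γ.continuous
  have hzK : z ∈ K := ⟨1, γ.target⟩
  have hzK' : z' ∈ K := ⟨0, γ.source⟩
  -- logarithm off `K`
  have n1 : ∀ (t) (ξ : ↥Kᶜ), (ξ : ℂ) - γ t ≠ 0 := fun t ξ h =>
    ξ.2 ⟨t, (sub_eq_zero.1 h).symm⟩
  have n1' : ∀ (ξ : ↥Kᶜ), (ξ : ℂ) - z' ≠ 0 := fun ξ => by simpa using n1 0 ξ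
  have n2 : ∀ (t) (ζ : ↥(φ '' K)ᶜ), (ζ : ℂ) - φ (γ t) ≠ 0 := fun t ζ h =>
    ζ.2 ⟨γ t, ⟨t, rfl⟩, (sub_eq_zero.1 h).symm⟩
  have n2' : ∀ (ζ : ↥(φ '' K)ᶜ), (ζ : ℂ) - φ z' ≠ 0 := fun ζ => by simpa using n2 0 ζ
  have n3 : ∀ (t) (ξ : D), dslope φ (γ t) (ξ : ℂ) ≠ 0 := fun t ξ =>
    hφ.dslope_ne_zero hDo hΩo ξ.2 (hγ t)
  have n3' : ∀ (ξ : D), dslope φ z' (ξ : ℂ) ≠ 0 := fun ξ => by simpa using n3 0 ξ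
  have hcd := continuousOn_dslope_prod hDo hφ.1
  obtain ⟨L1, c1, e1, s1⟩ := exists_log_homotopy
    (fun p : unitInterval × ↥Kᶜ => ((p.2 : ℂ) - γ p.1) / ((p.2 : ℂ) - z'))
    (by refine Continuous.div (by fun_prop) (by fun_prop) (fun p => n1' p.2))
    (fun p => div_ne_zero (n1 _ _) (n1' _)) (fun x => by simp [n1' x])
  obtain ⟨L2, c2, e2, s2⟩ := exists_log_homotopy
    (fun p : unitInterval × ↥(φ '' K)ᶜ => ((p.2 : ℂ) - φ (γ p.1)) / ((p.2 : ℂ) - φ z'))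
    (by
      refine Continuous.div ?_ (by fun_prop) (fun p => n2' p.2)
      exact Continuous.sub (by fun_prop) (hφγ.comp continuous_fst))
    (fun p => div_ne_zero (n2 _ _) (n2' _)) (fun x => by simp [n2' x])
  obtain ⟨L3, c3, e3, s3⟩ := exists_log_homotopy
    (fun p : unitInterval × D => dslope φ (γ p.1) (p.2 : ℂ) / dslope φ z' (p.2 : ℂ))
    (by
      refine Continuous.div ?_ ?_ (fun p => n3' p.2)
      · exact hcd.comp_continuous (f := fun p : unitInterval × D => ((p.2 : ℂ), γ p.1))
          (by fun_prop) (fun p => ⟨p.2.2, hγ _⟩)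
      · exact hcd.comp_continuous (f := fun p : unitInterval × D => ((p.2 : ℂ), z'))
          (by fun_prop) (fun p => ⟨p.2.2, hz'⟩))
    (fun p => div_ne_zero (n3 _ _) (n3' _)) (fun x => by simp [n3' x])
  classical
  refine ⟨K, fun ξ => if hx : ξ ∈ Kᶜ then L1 (1, ⟨ξ, hx⟩) else 0,
    fun ξ => if hx : ξ ∈ (φ '' K)ᶜ then L2 (1, ⟨ξ, hx⟩) else 0,
    fun ξ => if hx : ξ ∈ D then L3 (1, ⟨ξ, hx⟩) else 0, hKc, hKD, hzK, hzK',
    ?_, ?_, ?_, ?_, ?_, ?_, ?_⟩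
  · rw [continuousOn_iff_continuous_domRestrict]
    have : Continuous fun ξ : ↥Kᶜ => L1 (1, ξ) := c1.comp (by fun_prop)
    convert this using 2 with ξ
    exact dif_pos ξ.2
  · rw [continuousOn_iff_continuous_domRestrict]
    have : Continuous fun ξ : ↥(φ '' K)ᶜ => L2 (1, ξ) := c2.comp (by fun_prop)
    convert this using 2 with ξ
    exact dif_pos ξ.2
  · rw [continuousOn_iff_continuous_domRestrict]
    have : Continuous fun ξ : D => L3 (1, ξ) := c3.comp (by fun_prop)
    convert this using 2 with ξ
    exact dif_pos ξ.2
  · intro ξ hξ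
    simp only [hξ, dif_pos]
    simpa using e1 (1, ⟨ξ, hξ⟩)
  · intro ξ hξ
    simp only [hξ, dif_pos]
    simpa using e2 (1, ⟨ξ, hξ⟩)
  · intro ξ hξ h1 h2
    simp only [hξ, dif_pos]
    rw [e3]
    simp only [γ.target]
    rw [dslope_of_ne _ h1, dslope_of_ne _ h2, slope_def_field, slope_def_field]
    have a1 := sub_ne_zero.2 h1
    have a2 := sub_ne_zero.2 h2
    have a3 : φ ξ - φ z' ≠ 0 := sub_ne_zero.2 fun h => h2 (hφ.2.injOn hξ hz' h)
    field_simp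
  · rintro ξ ⟨hξ, hξK⟩
    have hξK' : ξ ∈ Kᶜ := hξK
    have hφξ : φ ξ ∈ (φ '' K)ᶜ := by
      rintro ⟨x, hx, hxe⟩
      exact hξK (hφ.2.injOn (hKD hx) hξ hxe ▸ hx)
    simp only [hφξ, hξ, hξK', dif_pos]
    refine eq_of_exp_eq (A := unitInterval) (f := fun t => L2 (t, ⟨φ ξ, hφξ⟩))
      (g := fun t => L3 (t, ⟨ξ, hξ⟩) + L1 (t, ⟨ξ, hξK'⟩)) (c2.comp (by fun_prop))
      ((c3.comp (by fun_prop)).add (c1.comp (by fun_prop))) ?_ 0 (by simp [s1, s2, s3]) 1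
    intro t
    rw [Complex.exp_add, e1, e2, e3]
    have h1 : ξ ≠ γ t := fun h => hξK ⟨t, h.symm⟩
    have h2 : ξ ≠ z' := fun h => hξK (h ▸ hzK')
    simp only
    rw [dslope_of_ne _ h1, dslope_of_ne _ h2, slope_def_field, slope_def_field]
    have a1 := sub_ne_zero.2 h1
    have a2 := sub_ne_zero.2 h2
    have a3 : φ ξ - φ z' ≠ 0 := sub_ne_zero.2 fun h => h2 (hφ.2.injOn hξ hz' h)
    field_simp

/-- Mutually inverse conformal homeomorphisms between two bounded planar domains. -/
structure BoundedConformalPair (D Ω : Set ℂ) (φ ψ : ℂ → ℂ) : Prop where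
  source : IsPlanarDomain D
  source_bdd : Bornology.IsBounded D
  target : IsPlanarDomain Ω
  target_bdd : Bornology.IsBounded Ω
  map : IsConformalHomeoOnto φ D Ω
  inv : IsConformalHomeoOnto ψ Ω D
  invOn : InvOn ψ φ D Ω

/-- The closure of the graph of `φ` over `D`. -/
def graphClosure (D : Set ℂ) (φ : ℂ → ℂ) : Set (ℂ × ℂ) :=
  closure ((fun ξ => (ξ, φ ξ)) '' D)

theorem isClosed_graphClosure (D : Set ℂ) (φ : ℂ → ℂ) : IsClosed (graphClosure D φ) :=
  isClosed_closure

theorem mem_graphClosure_iff_seq {D : Set ℂ} {φ : ℂ → ℂ} {z p : ℂ} :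
    (z, p) ∈ graphClosure D φ ↔ ∃ x : ℕ → ℂ, (∀ n, x n ∈ D) ∧ Tendsto x atTop (𝓝 z) ∧
      Tendsto (fun n => φ (x n)) atTop (𝓝 p) := by
  rw [graphClosure, mem_closure_iff_seq_limit]
  constructor
  · rintro ⟨y, hy, hlim⟩
    choose x hx hxy using hy
    rw [Prod.tendsto_iff] at hlim
    refine ⟨x, hx, ?_, ?_⟩
    · simpa [← hxy] using hlim.1
    · simpa [← hxy] using hlim.2
  · rintro ⟨x, hx, h1, h2⟩
    exact ⟨fun n => (x n, φ (x n)), fun n => ⟨x n, hx n, rfl⟩, h1.prodMk_nhds h2⟩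

theorem exists_mem_ball_of_mem_graphClosure {D : Set ℂ} {φ : ℂ → ℂ} {z p : ℂ}
    (h : (z, p) ∈ graphClosure D φ) {ε : ℝ} (hε : 0 < ε) {U : Set ℂ} (hU : IsOpen U)
    (hz : z ∈ U) : ∃ ξ ∈ D, ξ ∈ U ∧ φ ξ ∈ ball p ε := by
  obtain ⟨x, hx, h1, h2⟩ := mem_graphClosure_iff_seq.1 h
  obtain ⟨n, hn1, hn2⟩ := ((h1.eventually_mem (hU.mem_nhds hz)).and
    (h2.eventually_mem (ball_mem_nhds p hε))).exists
  exact ⟨x n, hx n, hn1, hn2⟩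

namespace BoundedConformalPair

variable {D Ω : Set ℂ} {φ ψ : ℂ → ℂ}

theorem symm (h : BoundedConformalPair D Ω φ ψ) : BoundedConformalPair Ω D ψ φ :=
  ⟨h.target, h.target_bdd, h.source, h.source_bdd, h.inv, h.map, h.invOn.symm⟩

theorem isOpen_source (h : BoundedConformalPair D Ω φ ψ) : IsOpen D := h.source.2.1

theorem continuousOn (h : BoundedConformalPair D Ω φ ψ) : ContinuousOn φ D :=
  h.map.1.continuousOn

theorem mapsTo (h : BoundedConformalPair D Ω φ ψ) : MapsTo φ D Ω := h.map.2.mapsTo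

theorem fst_mem_closure {z p : ℂ}
    (hzp : (z, p) ∈ graphClosure D φ) : z ∈ closure D := by
  obtain ⟨x, hx, h1, -⟩ := mem_graphClosure_iff_seq.1 hzp
  exact mem_closure_of_tendsto h1 (Eventually.of_forall hx)

theorem snd_mem_closure (h : BoundedConformalPair D Ω φ ψ) {z p : ℂ}
    (hzp : (z, p) ∈ graphClosure D φ) : p ∈ closure Ω := by
  obtain ⟨x, hx, -, h1⟩ := mem_graphClosure_iff_seq.1 hzp
  exact mem_closure_of_tendsto h1 (Eventually.of_forall fun n => h.mapsTo (hx n))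

theorem mem_swap (h : BoundedConformalPair D Ω φ ψ) {z p : ℂ}
    (hzp : (z, p) ∈ graphClosure D φ) : (p, z) ∈ graphClosure Ω ψ := by
  obtain ⟨x, hx, h1, h2⟩ := mem_graphClosure_iff_seq.1 hzp
  refine mem_graphClosure_iff_seq.2 ⟨fun n => φ (x n), fun n => h.mapsTo (hx n), h2, ?_⟩
  simpa [h.invOn.1 (hx _)] using h1

theorem eq_of_mem (h : BoundedConformalPair D Ω φ ψ) {z p : ℂ}
    (hzp : (z, p) ∈ graphClosure D φ) (hz : z ∈ D) : p = φ z := by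
  obtain ⟨x, hx, h1, h2⟩ := mem_graphClosure_iff_seq.1 hzp
  exact tendsto_nhds_unique h2
    ((h.continuousOn.continuousAt (h.isOpen_source.mem_nhds hz)).tendsto.comp h1)

theorem mem_graphClosure_self {z : ℂ} (hz : z ∈ D) : (z, φ z) ∈ graphClosure D φ :=
  subset_closure ⟨z, hz, rfl⟩

theorem isCompact_graphClosure (h : BoundedConformalPair D Ω φ ψ) :
    IsCompact (graphClosure D φ) := by
  refine (h.source_bdd.prod h.target_bdd).isCompact_closure.of_isClosed_subset isClosed_closure ?_
  refine closure_mono ?_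
  rintro _ ⟨ξ, hξ, rfl⟩
  exact ⟨hξ, h.mapsTo hξ⟩

theorem exists_mem_graphClosure (h : BoundedConformalPair D Ω φ ψ) {z : ℂ}
    (hz : z ∈ closure D) : ∃ p, (z, p) ∈ graphClosure D φ := by
  have h1 : IsClosed (Prod.fst '' graphClosure D φ) :=
    (h.isCompact_graphClosure.image continuous_fst).isClosed
  have h2 : closure D ⊆ Prod.fst '' graphClosure D φ := by
    refine closure_minimal ?_ h1
    exact fun ξ hξ => ⟨_, mem_graphClosure_self hξ, rfl⟩
  obtain ⟨⟨a, p⟩, h3, rfl⟩ := h2 hz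
  exact ⟨p, h3⟩

theorem snd_mem_frontier (h : BoundedConformalPair D Ω φ ψ) {z p : ℂ}
    (hzp : (z, p) ∈ graphClosure D φ) (hz : z ∈ frontier D) : p ∈ frontier Ω := by
  rw [h.target.2.1.frontier_eq]
  refine ⟨h.snd_mem_closure hzp, fun hp => ?_⟩
  have := h.symm.eq_of_mem (h.mem_swap hzp) hp
  rw [h.isOpen_source.frontier_eq] at hz
  exact hz.2 (this ▸ h.symm.mapsTo hp)

theorem fst_mem_frontier (h : BoundedConformalPair D Ω φ ψ) {z p : ℂ}
    (hzp : (z, p) ∈ graphClosure D φ) (hp : p ∈ frontier Ω) : z ∈ frontier D :=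
  h.symm.snd_mem_frontier (h.mem_swap hzp) hp

theorem isCompact_frontier (h : BoundedConformalPair D Ω φ ψ) : IsCompact (frontier D) :=
  h.source_bdd.isCompact_closure.of_isClosed_subset isClosed_frontier frontier_subset_closure

end BoundedConformalPair

/-- On a ball missing `w'`, the map `ζ ↦ ζ - w'` has, up to a constant, values in the slit plane. -/
theorem div_mem_slitPlane_of_mem_ball {a ζ w : ℂ} {ε : ℝ} (hζ : ζ ∈ ball a ε)
    (hw : w ∉ ball a ε) : (ζ - w) / (a - w) ∈ Complex.slitPlane := by
  have hε : 0 < ε := pos_of_mem_ball hζ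
  have h0 : a - w ≠ 0 := by
    intro h
    exact hw (sub_eq_zero.1 h ▸ mem_ball_self hε)
  have h1 : (ζ - w) / (a - w) = 1 + (ζ - a) / (a - w) := by field_simp; ring
  rw [h1]
  apply Complex.mem_slitPlane_of_norm_lt_one
  rw [norm_div, div_lt_one (norm_pos_iff.2 h0)]
  rw [mem_ball, dist_eq_norm] at hζ
  rw [mem_ball, dist_comm, dist_eq_norm, not_lt] at hw
  linarith

/-- A quotient of linear factors has a continuous logarithm on every ball missing both its zero
and its pole. -/
theorem exists_log_div_on_ball {a w w' : ℂ} {ε : ℝ} (hε : 0 < ε) (hw : w ∉ ball a ε)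
    (hw' : w' ∉ ball a ε) : ∃ g : ℂ → ℂ, ContinuousOn g (ball a ε) ∧
      ∀ ζ ∈ ball a ε, Complex.exp (g ζ) = (ζ - w) / (ζ - w') := by
  have n1 : ∀ u, u ∉ ball a ε → a - u ≠ 0 := fun u hu h =>
    hu (sub_eq_zero.1 h ▸ mem_ball_self hε)
  refine ⟨fun ζ => Complex.log ((ζ - w) / (a - w)) - Complex.log ((ζ - w') / (a - w'))
    + Complex.log ((a - w) / (a - w')), ?_, ?_⟩
  · refine ((ContinuousOn.clog (by fun_prop) fun ζ hζ => div_mem_slitPlane_of_mem_ball hζ hw).sub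
      (ContinuousOn.clog (by fun_prop) fun ζ hζ => div_mem_slitPlane_of_mem_ball hζ hw')).add
      continuousOn_const
  · intro ζ hζ
    have h1 := n1 w hw
    have h2 := n1 w' hw'
    have h3 := Complex.slitPlane_ne_zero (div_mem_slitPlane_of_mem_ball hζ hw)
    have h4 := Complex.slitPlane_ne_zero (div_mem_slitPlane_of_mem_ball hζ hw')
    rw [Complex.exp_add, Complex.exp_sub, Complex.exp_log h3, Complex.exp_log h4,
      Complex.exp_log (div_ne_zero h1 h2)]
    have h5 : ζ - w' ≠ 0 := by
      intro h; rw [h] at h4; simp at h4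
    field_simp

namespace BoundedConformalPair

variable {D Ω : Set ℂ} {φ ψ : ℂ → ℂ}

/-- A point of the closed domain cannot be approached through the images of both sides of a
separation of the boundary. -/
theorem false_of_split (hc : BoundedConformalPair D Ω φ ψ) {E₁ E₂ : Set ℂ} (h₁ : IsClosed E₁)
    (h₂ : IsClosed E₂) (hE₁ : E₁ ⊆ frontier D) (hdisj : Disjoint E₁ E₂)
    (hcov : frontier D ⊆ E₁ ∪ E₂) {z₁ z₂ p : ℂ} (hz₁ : z₁ ∈ E₁) (hz₂ : z₂ ∈ E₂)
    (hp₁ : (z₁, p) ∈ graphClosure D φ) (hp₂ : (z₂, p) ∈ graphClosure D φ) : False := by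
  have hE₁c : IsCompact E₁ := hc.isCompact_frontier.of_isClosed_subset h₁ hE₁
  obtain ⟨δ, hδ, hth⟩ := hdisj.exists_thickenings hE₁c h₂
  set G := thickening δ E₁ with hG
  have hGo : IsOpen G := isOpen_thickening
  have hGb : Bornology.IsBounded G := hE₁c.isBounded.thickening
  have hGcl : Disjoint (closure G) (thickening δ E₂) := hth.closure_left isOpen_thickening
  have hfr : Disjoint (frontier G) (frontier D) := by
    rw [Set.disjoint_left]
    intro x hx hxD
    rw [hGo.frontier_eq] at hx
    rcases hcov hxD with h | h
    · exact hx.2 (self_subset_thickening hδ _ h)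
    · exact Set.disjoint_left.1 hGcl hx.1 (self_subset_thickening hδ _ h)
  have hfrD : ∀ x ∈ frontier G, x ∉ D → x ∉ closure D := by
    intro x hx hxD hxc
    exact Set.disjoint_left.1 hfr hx (by rw [hc.isOpen_source.frontier_eq]; exact ⟨hxc, hxD⟩)
  have hΓ : IsCompact (frontier G ∩ D) := by
    have : frontier G ∩ D = frontier G ∩ closure D := by
      refine Subset.antisymm (inter_subset_inter_right _ subset_closure) ?_
      rintro x ⟨hx, hxD⟩
      refine ⟨hx, ?_⟩
      by_contra h
      exact hfrD x hx h hxD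
    rw [this]
    exact hc.source_bdd.isCompact_closure.inter_left isClosed_frontier
  have hpf : p ∈ frontier Ω := hc.snd_mem_frontier hp₁ (hE₁ hz₁)
  have hpn : p ∉ φ '' (frontier G ∩ D) := by
    rintro ⟨x, hx, rfl⟩
    rw [hc.target.2.1.frontier_eq] at hpf
    exact hpf.2 (hc.mapsTo hx.2)
  have hcl : IsClosed (φ '' (frontier G ∩ D)) :=
    (hΓ.image_of_continuousOn (hc.continuousOn.mono inter_subset_right)).isClosed
  obtain ⟨ε, hε, hball⟩ := Metric.isOpen_iff.1 hcl.isOpen_compl p hpn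
  obtain ⟨z, hzD, hzG, hz⟩ := exists_mem_ball_of_mem_graphClosure hp₁ (ε := ε / 4) (by positivity)
    hGo (self_subset_thickening hδ _ hz₁)
  obtain ⟨z', hzD', hzG', hz'⟩ := exists_mem_ball_of_mem_graphClosure hp₂ (ε := ε / 4)
    (by positivity) (isOpen_thickening (δ := δ) (E := E₂)) (self_subset_thickening hδ _ hz₂)
  obtain ⟨K, l, h, q, -, hKD, hzK, hzK', hl, -, hq, hle, -, hqe, -⟩ :=
    hc.map.exists_logs hc.source hc.target.2.1 hzD hzD'
  have hslit : ∀ ξ ∈ frontier G ∩ D,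
      (φ ξ - φ z) / (φ ξ - φ z') ∈ Complex.slitPlane := by
    intro ξ hξ
    have h1 : φ ξ ∉ ball p ε := fun hb => hball hb ⟨ξ, hξ, rfl⟩
    have h2 := div_mem_slitPlane_of_mem_ball (a := φ z') (ζ := φ z) (w := φ ξ) (ε := ε / 2) ?_ ?_
    · rwa [← neg_sub (φ ξ) (φ z), ← neg_sub (φ ξ) (φ z'), neg_div_neg_eq] at h2
    · rw [mem_ball] at hz hz' ⊢
      linarith [dist_triangle_right (φ z) (φ z') p]
    · rw [mem_ball] at hz hz' h1 ⊢
      linarith [dist_triangle (φ ξ) (φ z') p]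
  have hzfr : ∀ ξ ∈ frontier G, ξ ≠ z ∧ ξ ≠ z' := by
    intro ξ hξ
    rw [hGo.frontier_eq] at hξ
    constructor
    · rintro rfl; exact hξ.2 hzG
    · rintro rfl; exact Set.disjoint_left.1 hGcl hξ.1 hzG'
  classical
  let L : ℂ → ℂ := fun ξ => if ξ ∈ D then Complex.log ((φ ξ - φ z) / (φ ξ - φ z')) - q ξ else l ξ
  refine not_exists_log_frontier hGb hzG
    (fun hcl => Set.disjoint_left.1 hGcl hcl hzG') (L := L) ?_ ?_
  · intro ξ hξ
    by_cases hξD : ξ ∈ D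
    · have e : L =ᶠ[𝓝 ξ] fun ξ => Complex.log ((φ ξ - φ z) / (φ ξ - φ z')) - q ξ := by
        filter_upwards [hc.isOpen_source.mem_nhds hξD] with x hx
        simp only [L, hx, if_true]
      have hφξ : ContinuousAt φ ξ := hc.continuousOn.continuousAt (hc.isOpen_source.mem_nhds hξD)
      have hqξ : ContinuousAt q ξ := hq.continuousAt (hc.isOpen_source.mem_nhds hξD)
      have hs := hslit ξ ⟨hξ, hξD⟩
      have hne : φ ξ - φ z' ≠ 0 := by
        intro h0; rw [h0] at hs; simp at hs
      refine (ContinuousAt.congr ?_ e.symm).continuousWithinAt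
      exact (((hφξ.sub continuousAt_const).div (hφξ.sub continuousAt_const) hne).clog hs).sub hqξ
    · have hξc := hfrD ξ hξ hξD
      have e : L =ᶠ[𝓝 ξ] l := by
        filter_upwards [isClosed_closure.isOpen_compl.mem_nhds hξc] with x hx
        have : x ∉ D := fun h => hx (subset_closure h)
        simp only [L, this, if_false]
      refine (ContinuousAt.congr ?_ e.symm).continuousWithinAt
      have hco : IsOpen (closure D)ᶜ := isClosed_closure.isOpen_compl
      refine (hl.mono (s := Kᶜ) (t := (closure D)ᶜ) ?_).continuousAt (hco.mem_nhds hξc)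
      exact compl_subset_compl.2 (hKD.trans subset_closure)
  · intro ξ hξ
    obtain ⟨n1, n2⟩ := hzfr ξ hξ
    by_cases hξD : ξ ∈ D
    · simp only [L, hξD, if_true]
      rw [Complex.exp_sub, Complex.exp_log (Complex.slitPlane_ne_zero (hslit ξ ⟨hξ, hξD⟩)),
        ← hqe ξ hξD n1 n2]
      field_simp [Complex.exp_ne_zero]
    · simp only [L, hξD, if_false]
      exact hle ξ fun hK => hξD (hKD hK)

end BoundedConformalPair

/-- Points in different components of a compact set are separated by a splitting into two disjoint
closed sets. -/
theorem exists_split_of_connectedComponentIn_ne {X : Type*} [TopologicalSpace X] [T2Space X]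
    {M : Set X} (hM : IsCompact M) {x y : X}
    (hx : x ∈ M) (hy : y ∈ M) (hne : connectedComponentIn M x ≠ connectedComponentIn M y) :
    ∃ E₁ E₂ : Set X, IsClosed E₁ ∧ IsClosed E₂ ∧ Disjoint E₁ E₂ ∧ E₁ ∪ E₂ = M ∧
      x ∈ E₁ ∧ y ∈ E₂ := by
  have : CompactSpace M := isCompact_iff_compactSpace.1 hM
  have h1 : (⟨y, hy⟩ : M) ∉ connectedComponent (⟨x, hx⟩ : M) := by
    intro h
    apply hne
    apply connectedComponentIn_eq
    rw [connectedComponentIn_eq_image hx]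
    exact ⟨_, h, rfl⟩
  rw [connectedComponent_eq_iInter_isClopen] at h1
  simp only [mem_iInter, not_forall] at h1
  obtain ⟨⟨s, hs, hxs⟩, hys⟩ := h1
  have hval : IsClosedEmbedding (Subtype.val : M → X) := hM.isClosed.isClosedEmbedding_subtypeVal
  refine ⟨Subtype.val '' s, Subtype.val '' sᶜ, hval.isClosedMap _ hs.1,
    hval.isClosedMap _ hs.compl.1, ?_, ?_, ⟨_, hxs, rfl⟩, ⟨_, hys, rfl⟩⟩
  · exact (disjoint_image_iff Subtype.val_injective).2 disjoint_compl_right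
  · rw [← image_union, union_compl_self, image_univ, Subtype.range_coe]

theorem connectedComponentIn_ne_of_split {X : Type*} [TopologicalSpace X]
    {M E₁ E₂ : Set X} (h₁ : IsClosed E₁) (h₂ : IsClosed E₂) (hd : Disjoint E₁ E₂)
    (hM : M ⊆ E₁ ∪ E₂) {x y : X} (hxM : x ∈ M) (hyM : y ∈ M) (hx : x ∈ E₁) (hy : y ∈ E₂) :
    connectedComponentIn M x ≠ connectedComponentIn M y := by
  intro h
  have hpre : IsPreconnected (connectedComponentIn M x) := isPreconnected_connectedComponentIn
  have hyC : y ∈ connectedComponentIn M x := h ▸ mem_connectedComponentIn hyM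
  obtain ⟨a, -, ha⟩ := isPreconnected_closed_iff.1 hpre E₁ E₂ h₁ h₂
    ((connectedComponentIn_subset M x).trans hM) ⟨x, mem_connectedComponentIn hxM, hx⟩
    ⟨y, hyC, hy⟩
  exact Set.disjoint_left.1 hd ha.1 ha.2

/-- Being in the same component of a compact set is a closed relation. -/
theorem connectedComponentIn_eq_of_tendsto {X : Type*} [TopologicalSpace X] [T2Space X]
    {M : Set X} (hM : IsCompact M) {u v : ℕ → X} {x y : X} (hu : ∀ n, u n ∈ M)
    (hv : ∀ n, v n ∈ M) (huv : ∀ n, connectedComponentIn M (u n) = connectedComponentIn M (v n))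
    (hux : Tendsto u atTop (𝓝 x)) (hvy : Tendsto v atTop (𝓝 y)) :
    connectedComponentIn M x = connectedComponentIn M y := by
  have hx : x ∈ M := hM.isClosed.mem_of_tendsto hux (Eventually.of_forall hu)
  have hy : y ∈ M := hM.isClosed.mem_of_tendsto hvy (Eventually.of_forall hv)
  by_contra hne
  obtain ⟨E₁, E₂, h₁, h₂, hd, hE, hx₁, hy₂⟩ := exists_split_of_connectedComponentIn_ne hM hx hy hne
  have hx2 : x ∉ E₂ := Set.disjoint_left.1 hd hx₁
  have hy1 : y ∉ E₁ := Set.disjoint_right.1 hd hy₂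
  obtain ⟨n, hn1, hn2⟩ := ((hux.eventually_mem (h₂.isOpen_compl.mem_nhds hx2)).and
    (hvy.eventually_mem (h₁.isOpen_compl.mem_nhds hy1))).exists
  have hun : u n ∈ E₁ := (hE.ge (hu n)).resolve_right hn1
  have hvn : v n ∈ E₂ := (hE.ge (hv n)).resolve_left hn2
  exact connectedComponentIn_ne_of_split h₁ h₂ hd hE.ge (hu n) (hv n) hun hvn (huv n)

namespace BoundedConformalPair

variable {D Ω : Set ℂ} {φ ψ : ℂ → ℂ}

theorem connectedComponentIn_eq_of_eq (hc : BoundedConformalPair D Ω φ ψ) {z z' p p' : ℂ}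
    (hz : z ∈ frontier D) (hz' : z' ∈ frontier D)
    (hp : (z, p) ∈ graphClosure D φ) (hp' : (z', p') ∈ graphClosure D φ)
    (heq : connectedComponentIn (frontier D) z = connectedComponentIn (frontier D) z') :
    connectedComponentIn (frontier Ω) p = connectedComponentIn (frontier Ω) p' := by
  by_contra hne
  obtain ⟨F₁, F₂, h₁, h₂, hd, hF, hx₁, hy₂⟩ := exists_split_of_connectedComponentIn_ne
    hc.symm.isCompact_frontier (hc.snd_mem_frontier hp hz) (hc.snd_mem_frontier hp' hz') hne
  have hcl : ∀ F : Set ℂ, IsClosed F →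
      IsClosed (Prod.fst '' (graphClosure D φ ∩ Prod.snd ⁻¹' F)) := fun F hF =>
    ((hc.isCompact_graphClosure.inter_right (hF.preimage continuous_snd)).image
      continuous_fst).isClosed
  refine connectedComponentIn_ne_of_split (hcl F₁ h₁) (hcl F₂ h₂) ?_ ?_ hz hz'
    ⟨(z, p), ⟨hp, hx₁⟩, rfl⟩ ⟨(z', p'), ⟨hp', hy₂⟩, rfl⟩ heq
  · rw [Set.disjoint_left]
    rintro _ ⟨⟨a, b⟩, ⟨hab, hb⟩, rfl⟩ ⟨⟨a', b'⟩, ⟨hab', hb'⟩, rfl⟩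
    exact hc.symm.false_of_split h₁ h₂ (hF ▸ subset_union_left) hd hF.ge hb hb'
      (hc.mem_swap hab) (hc.mem_swap hab')
  · intro x hx
    obtain ⟨b, hb⟩ := hc.exists_mem_graphClosure (frontier_subset_closure hx)
    rcases hF.ge (hc.snd_mem_frontier hb hx) with h | h
    · exact Or.inl ⟨(x, b), ⟨hb, h⟩, rfl⟩
    · exact Or.inr ⟨(x, b), ⟨hb, h⟩, rfl⟩

theorem connectedComponentIn_eq_iff (hc : BoundedConformalPair D Ω φ ψ) {z z' p p' : ℂ}
    (hz : z ∈ frontier D) (hz' : z' ∈ frontier D)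
    (hp : (z, p) ∈ graphClosure D φ) (hp' : (z', p') ∈ graphClosure D φ) :
    connectedComponentIn (frontier D) z = connectedComponentIn (frontier D) z' ↔
    connectedComponentIn (frontier Ω) p = connectedComponentIn (frontier Ω) p' :=
  ⟨hc.connectedComponentIn_eq_of_eq hz hz' hp hp',
    hc.symm.connectedComponentIn_eq_of_eq (hc.snd_mem_frontier hp hz)
      (hc.snd_mem_frontier hp' hz') (hc.mem_swap hp) (hc.mem_swap hp')⟩

end BoundedConformalPair

theorem IsPreconnected.exists_mem_frontier {X : Type*} [TopologicalSpace X] {s Z : Set X}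
    (hs : IsPreconnected s) {x y : X} (hx : x ∈ s) (hxZ : x ∈ Z) (hy : y ∈ s) (hyZ : y ∉ Z) :
    ∃ u ∈ s, u ∈ frontier Z := by
  by_contra! hno
  have hcov : s ⊆ interior Z ∪ (closure Z)ᶜ := by
    intro u hu
    by_cases h : u ∈ interior Z
    · exact Or.inl h
    · exact Or.inr fun hcl => hno u hu ⟨hcl, h⟩
  have hxi : x ∈ interior Z := by
    by_contra h; exact hno x hx ⟨subset_closure hxZ, h⟩
  have hyi : y ∈ (closure Z)ᶜ := fun h => hno y hy ⟨h, fun h' => hyZ (interior_subset h')⟩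
  obtain ⟨u, -, hu⟩ := hs _ _ isOpen_interior isClosed_closure.isOpen_compl hcov ⟨x, hx, hxi⟩
    ⟨y, hy, hyi⟩
  exact hu.2 (subset_closure (interior_subset hu.1))

theorem IsPreconnected.diam_le_of_mem {s : Set ℝ} (hs : IsPreconnected s) {x y : ℝ} (hx : x ∈ s)
    (hy : y ∈ s) : ENNReal.ofReal (dist x y) ≤ volume s := by
  have h1 : uIcc x y ⊆ s := hs.ordConnected.uIcc_subset hx hy
  refine le_trans (le_of_eq ?_) (measure_mono h1)
  rw [Real.volume_interval, Real.dist_eq, abs_sub_comm]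

theorem isClosed_sameComponent {X : Type*} [MetricSpace X] {M : Set X} (hM : IsCompact M) :
    IsClosed {q : X × X | q.1 ∈ M ∧ q.2 ∈ M ∧
      connectedComponentIn M q.1 = connectedComponentIn M q.2} := by
  refine isSeqClosed_iff_isClosed.1 ?_
  intro u q hu hq
  rw [Prod.tendsto_iff] at hq
  exact ⟨hM.isClosed.mem_of_tendsto hq.1 (Eventually.of_forall fun n => (hu n).1),
    hM.isClosed.mem_of_tendsto hq.2 (Eventually.of_forall fun n => (hu n).2.1),
    connectedComponentIn_eq_of_tendsto hM (fun n => (hu n).1) (fun n => (hu n).2.1)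
      (fun n => (hu n).2.2) hq.1 hq.2⟩

theorem frontier_component_eq {D : Set ℂ} (hDo : IsOpen D) {x : ℂ}
    (hcl : IsClosed (connectedComponentIn Dᶜ x)) :
    frontier (connectedComponentIn Dᶜ x) = connectedComponentIn Dᶜ x ∩ frontier D := by
  set Z := connectedComponentIn Dᶜ x
  have hZ : Z ⊆ Dᶜ := connectedComponentIn_subset _ _
  ext y
  rw [hcl.frontier_eq, hDo.frontier_eq]
  constructor
  · rintro ⟨hyZ, hyi⟩
    refine ⟨hyZ, ?_, hZ hyZ⟩
    by_contra hyc
    obtain ⟨ε, hε, hb⟩ := Metric.isOpen_iff.1 isClosed_closure.isOpen_compl y hyc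
    apply hyi
    have : ball y ε ⊆ Z := by
      have h1 : Z = connectedComponentIn Dᶜ y := connectedComponentIn_eq hyZ
      rw [h1]
      refine (convex_ball y ε).isPreconnected.subset_connectedComponentIn (mem_ball_self hε) ?_
      exact hb.trans (compl_subset_compl.2 subset_closure)
    exact interior_maximal this isOpen_ball (mem_ball_self hε)
  · rintro ⟨hyZ, hyc, -⟩
    refine ⟨hyZ, fun hyi => ?_⟩
    obtain ⟨u, hu, huD⟩ := mem_closure_iff.1 hyc _ isOpen_interior hyi
    exact hZ (interior_subset hu) huD

namespace IsCircleDomain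

variable {D : Set ℂ}

theorem isOpen (hD : IsCircleDomain D) : IsOpen D := hD.1.2.1

theorem component_cases (hD : IsCircleDomain D) {x : ℂ} (hx : x ∉ D) :
    connectedComponentIn Dᶜ x = {x} ∨
    (∃ c rad, 0 < rad ∧ connectedComponentIn Dᶜ x = closedBall c rad) ∨
    ∃ c rad, 0 < rad ∧ connectedComponentIn Dᶜ x = (ball c rad)ᶜ := by
  by_cases hb : Bornology.IsBounded (connectedComponentIn Dᶜ x)
  · rcases (hD.2.2 x hx).1 hb with h | h
    · exact Or.inl h
    · exact Or.inr (Or.inl h)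
  · exact Or.inr (Or.inr ((hD.2.2 x hx).2 hb))

theorem isClosed_component (hD : IsCircleDomain D) {x : ℂ} (hx : x ∉ D) :
    IsClosed (connectedComponentIn Dᶜ x) := by
  rcases hD.component_cases hx with h | ⟨c, r, -, h⟩ | ⟨c, r, -, h⟩ <;> rw [h]
  · exact isClosed_singleton
  · exact isClosed_closedBall
  · exact isOpen_ball.isClosed_compl

theorem frontier_cases (hD : IsCircleDomain D) {x : ℂ} (hx : x ∉ D) :
    frontier (connectedComponentIn Dᶜ x) = {x} ∨
    ∃ c rad, 0 < rad ∧ frontier (connectedComponentIn Dᶜ x) = sphere c rad := by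
  rcases hD.component_cases hx with h | ⟨c, r, hr, h⟩ | ⟨c, r, hr, h⟩ <;> rw [h]
  · left; rw [isClosed_singleton.frontier_eq, interior_singleton, sdiff_empty]
  · right; exact ⟨c, r, hr, frontier_closedBall c hr.ne'⟩
  · right; exact ⟨c, r, hr, by rw [frontier_compl, frontier_ball c hr.ne']⟩

theorem frontier_eq (hD : IsCircleDomain D) {x : ℂ} (hx : x ∉ D) :
    frontier (connectedComponentIn Dᶜ x) = connectedComponentIn Dᶜ x ∩ frontier D :=
  frontier_component_eq hD.isOpen (hD.isClosed_component hx)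

theorem isConnected_frontier (hD : IsCircleDomain D) {x : ℂ} (hx : x ∉ D) :
    IsConnected (frontier (connectedComponentIn Dᶜ x)) := by
  rcases hD.frontier_cases hx with h | ⟨c, r, hr, h⟩ <;> rw [h]
  · exact isConnected_singleton
  · exact isConnected_sphere (by simp [Complex.rank_real_complex]) c hr.le

theorem notMem_of_frontier (hD : IsCircleDomain D) {x : ℂ} (hx : x ∈ frontier D) : x ∉ D := by
  rw [hD.isOpen.frontier_eq] at hx; exact hx.2

theorem component_frontier_eq (hD : IsCircleDomain D) {x : ℂ} (hx : x ∈ frontier D) :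
    connectedComponentIn (frontier D) x = frontier (connectedComponentIn Dᶜ x) := by
  have hxD := hD.notMem_of_frontier hx
  have hxZ : x ∈ connectedComponentIn Dᶜ x := mem_connectedComponentIn hxD
  rw [hD.frontier_eq hxD]
  apply Subset.antisymm
  · refine subset_inter ?_ (connectedComponentIn_subset _ _)
    refine isPreconnected_connectedComponentIn.subset_connectedComponentIn
      (mem_connectedComponentIn hx) ?_
    exact (connectedComponentIn_subset _ _).trans fun y hy => hD.notMem_of_frontier hy
  · rw [← hD.frontier_eq hxD]
    refine (hD.isConnected_frontier hxD).isPreconnected.subset_connectedComponentIn ?_ ?_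
    · rw [hD.frontier_eq hxD]; exact ⟨hxZ, hx⟩
    · rw [hD.frontier_eq hxD]; exact inter_subset_right

theorem component_eq_iff (hD : IsCircleDomain D) {x y : ℂ} (hx : x ∈ frontier D)
    (hy : y ∈ frontier D) :
    connectedComponentIn (frontier D) x = connectedComponentIn (frontier D) y ↔
      connectedComponentIn Dᶜ x = connectedComponentIn Dᶜ y := by
  constructor
  · intro h
    have h1 : y ∈ connectedComponentIn (frontier D) x := h ▸ mem_connectedComponentIn hy
    rw [hD.component_frontier_eq hx, hD.frontier_eq (hD.notMem_of_frontier hx)] at h1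
    exact connectedComponentIn_eq h1.1
  · intro h
    rw [hD.component_frontier_eq hx, hD.component_frontier_eq hy, h]

end IsCircleDomain

/-- The correspondence sending a point of `D` to its image, and a point off `D` to the set of all
limits of `φ` along the boundary of its complementary component. -/
def boundaryFiber (D : Set ℂ) (φ : ℂ → ℂ) (ξ : ℂ) : Set ℂ :=
  {p | (ξ ∈ D ∧ p = φ ξ) ∨
    (ξ ∉ D ∧ ∃ z ∈ frontier D, z ∈ connectedComponentIn Dᶜ ξ ∧ (z, p) ∈ graphClosure D φ)}

theorem boundaryFiber_of_mem {D : Set ℂ} {φ : ℂ → ℂ} {ξ : ℂ} (hξ : ξ ∈ D) :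
    boundaryFiber D φ ξ = {φ ξ} := by
  ext p; simp [boundaryFiber, hξ]

theorem mem_boundaryFiber_of_notMem {D : Set ℂ} {φ : ℂ → ℂ} {ξ p : ℂ} (hξ : ξ ∉ D) :
    p ∈ boundaryFiber D φ ξ ↔
      ∃ z ∈ frontier D, z ∈ connectedComponentIn Dᶜ ξ ∧ (z, p) ∈ graphClosure D φ := by
  simp [boundaryFiber, hξ]

theorem boundaryFiber_congr {D : Set ℂ} {φ : ℂ → ℂ} {ξ ξ' : ℂ} (hξ : ξ ∉ D) (hξ' : ξ' ∉ D)
    (h : connectedComponentIn Dᶜ ξ = connectedComponentIn Dᶜ ξ') :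
    boundaryFiber D φ ξ = boundaryFiber D φ ξ' := by
  ext p; simp [boundaryFiber, hξ, hξ', h]

namespace BoundedConformalPair

variable {D Ω : Set ℂ} {φ ψ : ℂ → ℂ}

theorem mem_boundaryFiber_of_graph (hc : BoundedConformalPair D Ω φ ψ) {z p : ℂ}
    (h : (z, p) ∈ graphClosure D φ) : p ∈ boundaryFiber D φ z := by
  by_cases hz : z ∈ D
  · rw [boundaryFiber_of_mem hz]; exact hc.eq_of_mem h hz
  · rw [mem_boundaryFiber_of_notMem hz]
    refine ⟨z, ?_, mem_connectedComponentIn hz, h⟩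
    rw [hc.isOpen_source.frontier_eq]
    exact ⟨fst_mem_closure h, hz⟩

theorem boundaryFiber_subset_closure (hc : BoundedConformalPair D Ω φ ψ) (ξ : ℂ) :
    boundaryFiber D φ ξ ⊆ closure Ω := by
  rintro p (⟨h, rfl⟩ | ⟨-, z, -, -, h⟩)
  · exact subset_closure (hc.mapsTo h)
  · exact hc.snd_mem_closure h

theorem boundaryFiber_nonempty (hc : BoundedConformalPair D Ω φ ψ) (hD : IsCircleDomain D)
    (ξ : ℂ) : (boundaryFiber D φ ξ).Nonempty := by
  by_cases hξ : ξ ∈ D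
  · exact ⟨φ ξ, Or.inl ⟨hξ, rfl⟩⟩
  · obtain ⟨z, hz⟩ := (hD.isConnected_frontier hξ).nonempty
    rw [hD.frontier_eq hξ] at hz
    obtain ⟨p, hp⟩ := hc.exists_mem_graphClosure (frontier_subset_closure hz.2)
    exact ⟨p, Or.inr ⟨hξ, z, hz.2, hz.1, hp⟩⟩

theorem mem_frontier_of_mem_boundaryFiber (hc : BoundedConformalPair D Ω φ ψ) {ξ p : ℂ}
    (hξ : ξ ∉ D) (hp : p ∈ boundaryFiber D φ ξ) : p ∈ frontier Ω := by
  obtain ⟨z, hz, -, h⟩ := (mem_boundaryFiber_of_notMem hξ).1 hp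
  exact hc.snd_mem_frontier h hz

theorem boundaryFiber_eq_component (hc : BoundedConformalPair D Ω φ ψ) (hD : IsCircleDomain D)
    {ξ p : ℂ} (hξ : ξ ∉ D) (hp : p ∈ boundaryFiber D φ ξ) :
    boundaryFiber D φ ξ = connectedComponentIn (frontier Ω) p := by
  obtain ⟨z, hz, hzξ, h⟩ := (mem_boundaryFiber_of_notMem hξ).1 hp
  have e := connectedComponentIn_eq hzξ
  ext p'
  rw [mem_boundaryFiber_of_notMem hξ]
  constructor
  · rintro ⟨z', hz', hzξ', h'⟩
    have e' := connectedComponentIn_eq hzξ'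
    rw [(hc.connectedComponentIn_eq_iff hz hz' h h').1
      ((hD.component_eq_iff hz hz').2 (e.symm.trans e'))]
    exact mem_connectedComponentIn (hc.snd_mem_frontier h' hz')
  · intro hp'
    have hpf : p' ∈ frontier Ω := connectedComponentIn_subset _ _ hp'
    obtain ⟨z', h'⟩ := hc.symm.exists_mem_graphClosure (frontier_subset_closure hpf)
    replace h' := hc.symm.mem_swap h'
    have hz' := hc.fst_mem_frontier h' hpf
    refine ⟨z', hz', ?_, h'⟩
    have := (hD.component_eq_iff hz hz').1 ((hc.connectedComponentIn_eq_iff hz hz' h h').2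
      (connectedComponentIn_eq hp'))
    rw [e, this]
    exact mem_connectedComponentIn (hD.notMem_of_frontier hz')

theorem isPreconnected_boundaryFiber (hc : BoundedConformalPair D Ω φ ψ) (hD : IsCircleDomain D)
    (ξ : ℂ) : IsPreconnected (boundaryFiber D φ ξ) := by
  by_cases hξ : ξ ∈ D
  · rw [boundaryFiber_of_mem hξ]; exact isPreconnected_singleton
  · obtain ⟨p, hp⟩ := hc.boundaryFiber_nonempty hD ξ
    rw [hc.boundaryFiber_eq_component hD hξ hp]
    exact isPreconnected_connectedComponentIn

theorem component_eq_of_mem_boundaryFiber (hc : BoundedConformalPair D Ω φ ψ)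
    (hD : IsCircleDomain D) {ξ ξ' p : ℂ} (hξ : ξ ∉ D) (hξ' : ξ' ∉ D)
    (hp : p ∈ boundaryFiber D φ ξ) (hp' : p ∈ boundaryFiber D φ ξ') :
    connectedComponentIn Dᶜ ξ = connectedComponentIn Dᶜ ξ' := by
  obtain ⟨z, hz, hzξ, h⟩ := (mem_boundaryFiber_of_notMem hξ).1 hp
  obtain ⟨z', hz', hzξ', h'⟩ := (mem_boundaryFiber_of_notMem hξ').1 hp'
  rw [connectedComponentIn_eq hzξ, connectedComponentIn_eq hzξ']
  exact (hD.component_eq_iff hz hz').1 ((hc.connectedComponentIn_eq_iff hz hz' h h').2 rfl)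

theorem isClosed_boundaryFiber_graph (hc : BoundedConformalPair D Ω φ ψ) (hD : IsCircleDomain D) :
    IsClosed {q : ℂ × ℂ | q.2 ∈ boundaryFiber D φ q.1} := by
  refine isSeqClosed_iff_isClosed.1 ?_
  rintro u ⟨ξ, p⟩ hu hlim
  rw [Prod.tendsto_iff] at hlim
  obtain ⟨h1, h2⟩ := hlim
  simp only at h1 h2
  show p ∈ boundaryFiber D φ ξ
  by_cases hξ : ξ ∈ D
  · rw [boundaryFiber_of_mem hξ, mem_singleton_iff]
    refine tendsto_nhds_unique h2 (Tendsto.congr' ?_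
      ((hc.continuousOn.continuousAt (hc.isOpen_source.mem_nhds hξ)).tendsto.comp h1))
    filter_upwards [h1.eventually_mem (hc.isOpen_source.mem_nhds hξ)] with n hn
    have : (u n).2 ∈ boundaryFiber D φ (u n).1 := hu n
    rw [boundaryFiber_of_mem hn] at this
    exact this.symm
  set W₁ : Set (ℂ × ℂ) := {q : ℂ × ℂ | q.1 ∈ frontier D ∧ q.2 ∈ frontier D ∧
      connectedComponentIn (frontier D) q.1 = connectedComponentIn (frontier D) q.2}
  set W₂ : Set (ℂ × ℂ) := {q : ℂ × ℂ | q.1 = q.2}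
  set W₃ : Set (ℂ × ℂ) := Prod.snd ⁻¹' (connectedComponentIn Dᶜ ξ ∩ frontier D)
  have hW : IsClosed (W₁ ∪ (W₂ ∪ W₃)) :=
    (isClosed_sameComponent hc.isCompact_frontier).union
      ((isClosed_eq continuous_fst continuous_snd).union
        (((hD.isClosed_component hξ).inter isClosed_frontier).preimage continuous_snd))
  have key : ∀ n, ∃ y z, (z, (u n).2) ∈ graphClosure D φ ∧ dist y ξ ≤ dist (u n).1 ξ ∧
      (y, z) ∈ W₁ ∪ (W₂ ∪ W₃) := by
    intro n
    have hn : (u n).2 ∈ boundaryFiber D φ (u n).1 := hu n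
    by_cases hD1 : (u n).1 ∈ D
    · rw [boundaryFiber_of_mem hD1] at hn
      refine ⟨(u n).1, (u n).1, ?_, le_rfl, Or.inr (Or.inl rfl)⟩
      rw [hn]
      exact mem_graphClosure_self hD1
    · obtain ⟨z, hz, hzξ, h⟩ := (mem_boundaryFiber_of_notMem hD1).1 hn
      by_cases hZ : connectedComponentIn Dᶜ (u n).1 = connectedComponentIn Dᶜ ξ
      · exact ⟨(u n).1, z, h, le_rfl, Or.inr (Or.inr ⟨hZ ▸ hzξ, hz⟩)⟩
      · have hn1 : ξ ∉ connectedComponentIn Dᶜ (u n).1 := fun h' => hZ (connectedComponentIn_eq h')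
        obtain ⟨y, hy, hyZ⟩ := (convex_segment (𝕜 := ℝ) (u n).1 ξ).isPreconnected.exists_mem_frontier
          (left_mem_segment ℝ _ _) (mem_connectedComponentIn (F := Dᶜ) hD1)
          (right_mem_segment ℝ _ _) hn1
        refine ⟨y, z, h, ?_, Or.inl ?_⟩
        · exact (convex_closedBall ξ (dist (u n).1 ξ)).segment_subset
            (mem_closedBall.2 le_rfl) (mem_closedBall_self dist_nonneg) hy
        · rw [hD.frontier_eq hD1] at hyZ
          refine ⟨hyZ.2, hz, (hD.component_eq_iff hyZ.2 hz).2 ?_⟩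
          rw [← connectedComponentIn_eq hyZ.1, ← connectedComponentIn_eq hzξ]
  choose y z hzR hy hyz using key
  have hylim : Tendsto y atTop (𝓝 ξ) := by
    rw [tendsto_iff_dist_tendsto_zero] at h1 ⊢
    exact squeeze_zero (fun _ => dist_nonneg) hy h1
  obtain ⟨z₀, -, k, hk, hzlim⟩ := hc.source_bdd.isCompact_closure.tendsto_subseq
    (fun n => fst_mem_closure (hzR n))
  have hR : (z₀, p) ∈ graphClosure D φ := (isClosed_graphClosure D φ).mem_of_tendsto
    (hzlim.prodMk_nhds (h2.comp hk.tendsto_atTop)) (Eventually.of_forall fun n => hzR (k n))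
  have hWlim : (ξ, z₀) ∈ W₁ ∪ (W₂ ∪ W₃) := hW.mem_of_tendsto
    ((hylim.comp hk.tendsto_atTop).prodMk_nhds hzlim) (Eventually.of_forall fun n => hyz (k n))
  rcases hWlim with h | h | h
  · rw [mem_boundaryFiber_of_notMem hξ]
    refine ⟨z₀, h.2.1, ?_, hR⟩
    rw [(hD.component_eq_iff h.1 h.2.1).1 h.2.2]
    exact mem_connectedComponentIn (hD.notMem_of_frontier h.2.1)
  · have : ξ = z₀ := h
    rw [this]
    exact hc.mem_boundaryFiber_of_graph hR
  · rw [mem_boundaryFiber_of_notMem hξ]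
    exact ⟨z₀, h.2, h.1, hR⟩

theorem isClosed_boundaryFiber_preimage (hc : BoundedConformalPair D Ω φ ψ)
    (hD : IsCircleDomain D) {A : Set ℂ} (hA : IsClosed A) :
    IsClosed {ξ | (boundaryFiber D φ ξ ∩ A).Nonempty} := by
  refine isSeqClosed_iff_isClosed.1 ?_
  intro u ξ hu hlim
  choose p hp hpA using hu
  obtain ⟨p₀, -, k, hk, hplim⟩ := hc.target_bdd.isCompact_closure.tendsto_subseq
    (fun n => hc.boundaryFiber_subset_closure _ (hp n))
  have hmem : (ξ, p₀) ∈ {q : ℂ × ℂ | q.2 ∈ boundaryFiber D φ q.1} :=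
    (hc.isClosed_boundaryFiber_graph hD).mem_of_tendsto
      ((hlim.comp hk.tendsto_atTop).prodMk_nhds hplim) (Eventually.of_forall fun n => hp (k n))
  exact ⟨p₀, hmem, hA.mem_of_tendsto hplim (Eventually.of_forall fun n => hpA (k n))⟩

theorem isPreconnected_biUnion_boundaryFiber (hc : BoundedConformalPair D Ω φ ψ)
    (hD : IsCircleDomain D) {Y : Set ℂ} (hY : IsPreconnected Y) :
    IsPreconnected (⋃ ξ ∈ Y, boundaryFiber D φ ξ) := by
  rw [isPreconnected_closed_iff] at hY ⊢
  intro A B hA hB hcov ⟨a, ha, haA⟩ ⟨b, hb, hbB⟩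
  simp only [mem_iUnion, exists_prop] at ha hb
  obtain ⟨ξa, hξa, ha⟩ := ha
  obtain ⟨ξb, hξb, hb⟩ := hb
  have hsub : ∀ ξ ∈ Y, boundaryFiber D φ ξ ⊆ A ∪ B := fun ξ hξ =>
    (subset_biUnion_of_mem (u := boundaryFiber D φ) hξ).trans hcov
  obtain ⟨ξ, hξ, h1, h2⟩ := hY _ _ (hc.isClosed_boundaryFiber_preimage hD hA)
    (hc.isClosed_boundaryFiber_preimage hD hB) (by
      intro ξ hξ
      obtain ⟨p, hp⟩ := hc.boundaryFiber_nonempty hD ξ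
      rcases hsub ξ hξ hp with h | h
      · exact Or.inl ⟨p, hp, h⟩
      · exact Or.inr ⟨p, hp, h⟩) ⟨ξa, hξa, a, ha, haA⟩ ⟨ξb, hξb, b, hb, hbB⟩
  obtain ⟨p, hp, hp'⟩ := isPreconnected_closed_iff.1 (hc.isPreconnected_boundaryFiber hD ξ) A B hA hB
    (hsub ξ hξ) h1 h2
  exact ⟨p, mem_biUnion hξ hp, hp'⟩

end BoundedConformalPair

theorem locallyConnectedSpace_image_Icc {f : ℝ → ℂ} {a b : ℝ} (hf : ContinuousOn f (Icc a b)) :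
    LocallyConnectedSpace (f '' Icc a b) := by
  have : LocallyPathConnectedSpace (Icc a b) := (convex_Icc a b).locallyPathConnectedSpace
  let g : Icc a b → f '' Icc a b := fun t => ⟨f t, t, t.2, rfl⟩
  have hg : Continuous g :=
    (continuousOn_iff_continuous_domRestrict.1 hf).subtype_mk _
  have hs : Function.Surjective g := by
    rintro ⟨_, t, ht, rfl⟩
    exact ⟨⟨t, ht⟩, rfl⟩
  exact (hg.isClosedMap.isQuotientMap hg hs).isCoinducing.locallyConnectedSpace

theorem sphere_eq_image_Icc (c : ℂ) {r : ℝ} (hr : 0 ≤ r) :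
    sphere c r = circleMap c r '' Icc 0 (2 * Real.pi) := by
  apply Subset.antisymm
  · rw [← abs_of_nonneg hr, ← image_circleMap_Ioc, abs_of_nonneg hr]
    exact image_mono Ioc_subset_Icc_self
  · rintro _ ⟨t, -, rfl⟩
    exact circleMap_mem_sphere c hr t

theorem locallyConnectedSpace_image_sphere {f : ℂ → ℂ} {c : ℂ} {r : ℝ} (hr : 0 ≤ r)
    (hf : ContinuousOn f (sphere c r)) : LocallyConnectedSpace (f '' sphere c r) := by
  rw [sphere_eq_image_Icc c hr] at hf ⊢
  rw [← image_comp]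
  exact locallyConnectedSpace_image_Icc
    (hf.comp (continuous_circleMap c r).continuousOn (mapsTo_image _ _))

theorem finite_components_of_tsum_diam {K : Set ℂ}
    (hdiam : ∑' Q : ↥(NondegComponents K), ediam (Q : Set ℂ) < ⊤) {C : ℝ} (hC : 0 < C) :
    {Q : Set ℂ | (∃ x ∈ K, Q = connectedComponentIn K x) ∧ C < Metric.diam Q}.Finite := by
  have h1 := ENNReal.finite_const_le_of_tsum_ne_top hdiam.ne (ε := ENNReal.ofReal C)
    (by simpa using hC)
  refine (h1.image Subtype.val).subset ?_
  rintro Q ⟨hQ, hCQ⟩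
  have hnd : ¬ Q.Subsingleton := fun h => by
    rw [Metric.diam_subsingleton h] at hCQ; linarith
  rw [Set.not_subsingleton_iff] at hnd
  refine ⟨⟨Q, hQ, hnd⟩, ?_, rfl⟩
  exact ENNReal.ofReal_le_of_le_toReal hCQ.le

namespace BoundedConformalPair

variable {D Ω : Set ℂ} {φ ψ : ℂ → ℂ}

theorem isPeanoCompactum_of_extends (hc : BoundedConformalPair D Ω φ ψ) (hD : IsCircleDomain D)
    (hdiam : ∑' Q : ↥(NondegComponents (frontier Ω)), ediam (Q : Set ℂ) < ⊤)
    {φb : ℂ → ℂ} (hcont : ContinuousOn φb (closure D)) (heq : EqOn φb φ D) :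
    IsPeanoCompactum (frontier Ω) := by
  refine ⟨hc.symm.isCompact_frontier, ?_, fun C hC => finite_components_of_tsum_diam hdiam hC⟩
  intro p hp
  have hgr : ∀ {z p}, (z, p) ∈ graphClosure D φ → p = φb z := by
    intro z p h
    obtain ⟨x, hx, h1, h2⟩ := mem_graphClosure_iff_seq.1 h
    have h3 : Tendsto x atTop (𝓝[closure D] z) := tendsto_nhdsWithin_iff.2
      ⟨h1, Eventually.of_forall fun n => subset_closure (hx n)⟩
    refine tendsto_nhds_unique h2 (((hcont z (fst_mem_closure h)).tendsto.comp h3).congr ?_)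
    exact fun n => heq (hx n)
  obtain ⟨z, hzp⟩ := hc.symm.exists_mem_graphClosure (frontier_subset_closure hp)
  replace hzp := hc.symm.mem_swap hzp
  have hz := hc.fst_mem_frontier hzp hp
  have hzD := hD.notMem_of_frontier hz
  rw [← hc.boundaryFiber_eq_component hD hzD (hc.mem_boundaryFiber_of_graph hzp)]
  have e : boundaryFiber D φ z = φb '' frontier (connectedComponentIn Dᶜ z) := by
    rw [hD.frontier_eq hzD]
    ext p'
    rw [mem_boundaryFiber_of_notMem hzD]
    constructor
    · rintro ⟨z', h1, h2, h3⟩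
      exact ⟨z', ⟨h2, h1⟩, (hgr h3).symm⟩
    · rintro ⟨z', ⟨h2, h1⟩, rfl⟩
      obtain ⟨p', hp'⟩ := hc.exists_mem_graphClosure (frontier_subset_closure h1)
      exact ⟨z', h1, h2, hgr hp' ▸ hp'⟩
  have hsub : frontier (connectedComponentIn Dᶜ z) ⊆ closure D := by
    rw [hD.frontier_eq hzD]
    exact inter_subset_right.trans frontier_subset_closure
  rw [e]
  rcases hD.frontier_cases hzD with h | ⟨c, r, hr, h⟩
  · rw [h, image_singleton]
    have : ({φb z} : Set ℂ) = (fun _ : ℝ => φb z) '' Icc 0 1 := by simp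
    rw [this]
    exact locallyConnectedSpace_image_Icc continuousOn_const
  · rw [h] at hsub ⊢
    exact locallyConnectedSpace_image_sphere hr.le (hcont.mono hsub)

end BoundedConformalPair

theorem exists_uniform_locallyConnected {P : Set ℂ} (hP : IsCompact P)
    [LocallyConnectedSpace P] {ε : ℝ} (hε : 0 < ε) : ∃ η > 0, ∀ p ∈ P, ∀ q ∈ P, dist p q < η →
      ∃ C ⊆ P, IsPreconnected C ∧ p ∈ C ∧ q ∈ C ∧ C ⊆ ball p ε := by
  have key : ∀ x : P, ∃ U : Set ℂ, IsOpen U ∧ (x : ℂ) ∈ U ∧ IsPreconnected (U ∩ P) ∧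
      U ∩ P ⊆ ball (x : ℂ) (ε / 2) := by
    intro x
    have hn : (Subtype.val ⁻¹' ball (x : ℂ) (ε / 2) : Set P) ∈ 𝓝 x :=
      continuous_subtype_val.continuousAt.preimage_mem_nhds (ball_mem_nhds _ (by positivity))
    obtain ⟨V, hV, ⟨hVo, hxV, hVc⟩⟩ := locallyConnectedSpace_iff_subsets_isOpen_isConnected.1
      inferInstance x _ hn
    obtain ⟨U, hU, rfl⟩ := isOpen_induced_iff.1 hVo
    have e : U ∩ P = Subtype.val '' (Subtype.val ⁻¹' U : Set P) := by
      rw [Subtype.image_preimage_coe, inter_comm]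
    refine ⟨U, hU, hxV, ?_, ?_⟩
    · rw [e]; exact hVc.isPreconnected.image _ continuous_subtype_val.continuousOn
    · rw [e]; rintro _ ⟨y, hy, rfl⟩; exact hV hy
  choose U hUo hxU hUc hUb using key
  obtain ⟨η, hη, hleb⟩ := lebesgue_number_lemma_of_metric hP hUo
    (fun x hx => mem_iUnion.2 ⟨⟨x, hx⟩, hxU _⟩)
  refine ⟨η, hη, fun p hp q hq hpq => ?_⟩
  obtain ⟨x, hx⟩ := hleb p hp
  have hpU := hx (mem_ball_self hη)
  refine ⟨U x ∩ P, inter_subset_right, hUc x, ⟨hpU, hp⟩,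
    ⟨hx (by rwa [mem_ball, dist_comm]), hq⟩, fun y hy => ?_⟩
  have h1 := hUb x hy
  have h2 := hUb x ⟨hpU, hp⟩
  rw [mem_ball] at *
  linarith [dist_triangle_right y p x]

theorem Complex.eq_of_exp_eq_of_norm_lt {x y : ℂ} (h : Complex.exp x = Complex.exp y)
    (hxy : ‖x - y‖ < 1) : x = y := by
  obtain ⟨n, hn⟩ := Complex.exp_eq_exp_iff_exists_int.1 h
  have h1 : x - y = n * (2 * Real.pi * Complex.I) := by rw [hn]; ring
  by_cases h0 : n = 0
  · simpa [h0] using hn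
  · exfalso
    have h2 : (1 : ℝ) ≤ |(n : ℝ)| := by exact_mod_cast Int.one_le_abs h0
    rw [h1] at hxy
    simp only [norm_mul, Complex.norm_intCast, Complex.norm_ofNat, Complex.norm_real,
      Complex.norm_I, Real.norm_eq_abs, abs_of_pos Real.pi_pos, mul_one] at hxy
    nlinarith [Real.pi_gt_three]

theorem IsPreconnected.sub_eq_of_exp_eq {C : Set ℂ} (hC : IsPreconnected C) {f g : ℂ → ℂ}
    (hf : ContinuousOn f C) (hg : ContinuousOn g C)
    (h : ∀ x ∈ C, Complex.exp (f x) = Complex.exp (g x)) {x y : ℂ} (hx : x ∈ C) (hy : y ∈ C) :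
    f x - g x = f y - g y := by
  have : PreconnectedSpace C := isPreconnected_iff_preconnectedSpace.1 hC
  have hs : Complex.exp (f x - g x) = 1 := by
    rw [Complex.exp_sub, h x hx, div_self (Complex.exp_ne_zero _)]
  have := eq_of_exp_eq (A := C) (f := fun t => f t) (g := fun t => g t + (f x - g x))
    (continuousOn_iff_continuous_domRestrict.1 hf)
    ((continuousOn_iff_continuous_domRestrict.1 hg).add continuous_const) (by
      intro t
      rw [Complex.exp_add, hs, mul_one, h t t.2]) ⟨x, hx⟩ (by simp) ⟨y, hy⟩
  simp only at this
  rw [this]; ring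

namespace BoundedConformalPair

variable {D Ω : Set ℂ} {φ ψ : ℂ → ℂ}

theorem image_subset_ball_of_small (hc : BoundedConformalPair D Ω φ ψ) (hD : IsCircleDomain D)
    {z₀ : ℂ} (hz₀ : z₀ ∉ D) {r ε η : ℝ} (hr : 0 < r) (hε : 0 < ε) (hηε : η < ε / 2)
    (hloc : ∀ p ∈ boundaryFiber D φ z₀, ∀ q ∈ boundaryFiber D φ z₀, dist p q ≤ η →
      ∃ C ⊆ boundaryFiber D φ z₀, IsPreconnected C ∧ p ∈ C ∧ q ∈ C ∧ C ⊆ ball p (ε / 2))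
    (hX : ∀ p ∈ ⋃ ξ ∈ sphere z₀ r \ connectedComponentIn Dᶜ z₀, boundaryFiber D φ ξ,
      ∀ q ∈ ⋃ ξ ∈ sphere z₀ r \ connectedComponentIn Dᶜ z₀, boundaryFiber D φ ξ, dist p q ≤ η)
    {a : ℂ} (ha : a ∈ ⋃ ξ ∈ sphere z₀ r \ connectedComponentIn Dᶜ z₀, boundaryFiber D φ ξ) :
    (∀ z ∈ D, z ∈ ball z₀ r → φ z ∈ ball a ε) ∨
      ∀ z ∈ D, z ∉ closedBall z₀ r → φ z ∈ ball a ε := by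
  by_contra! hcon
  obtain ⟨⟨z, hzD, hzr, hza⟩, z', hzD', hzr', hza'⟩ := hcon
  set Z₀ := connectedComponentIn Dᶜ z₀ with hZ₀
  set X := ⋃ ξ ∈ sphere z₀ r \ Z₀, boundaryFiber D φ ξ with hXdef
  have hXcl : ∀ p ∈ closure X, ∀ q ∈ closure X, dist p q ≤ η := by
    intro p hp q hq
    have h1 : ∀ q ∈ X, dist p q ≤ η := fun q hq =>
      closure_minimal (t := {p | dist p q ≤ η}) (fun p hp => hX p hp q hq)
        (isClosed_le (by fun_prop) continuous_const) hp
    exact closure_minimal (t := {q | dist p q ≤ η}) h1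
        (isClosed_le (by fun_prop) continuous_const) hq
  have hXa : closure X ⊆ ball a (ε / 2) := fun p hp =>
    lt_of_le_of_lt (hXcl p hp a (subset_closure ha)) hηε
  have hball : ball a (ε / 2) ⊆ ball a ε := ball_subset_ball (by linarith)
  obtain ⟨g, hg, hge⟩ := exists_log_div_on_ball hε hza hza'
  obtain ⟨K, l, h, q, hKc, hKD, hzK, hzK', hl, hh, hq, hle, hhe, hqe, hhq⟩ :=
    hc.map.exists_logs hc.source hc.target.2.1 hzD hzD'
  have hφK : IsClosed (φ '' K) :=
    (hKc.image_of_continuousOn (hc.continuousOn.mono hKD)).isClosed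
  have hoff : ∀ ξ, ξ ∉ K → ∀ p ∈ boundaryFiber D φ ξ, p ∉ φ '' K := by
    rintro ξ hξ p hp ⟨x, hx, rfl⟩
    by_cases hξD : ξ ∈ D
    · rw [boundaryFiber_of_mem hξD, mem_singleton_iff] at hp
      exact hξ (hc.map.2.injOn (hKD hx) hξD hp ▸ hx)
    · have := hc.mem_frontier_of_mem_boundaryFiber hξD hp
      rw [hc.target.2.1.frontier_eq] at this
      exact this.2 (hc.mapsTo (hKD hx))
  set B := ball a ε \ φ '' K with hB
  have hBo : IsOpen B := isOpen_ball.sdiff hφK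
  set κ : ℂ → ℂ := fun p => h p - g p with hκ
  have hhB : ContinuousOn h B := hh.mono fun p hp => hp.2
  have hgB : ContinuousOn g B := hg.mono fun p hp => hp.1
  have hκc : ContinuousOn κ B := hhB.sub hgB
  have hexpB : ∀ p ∈ B, Complex.exp (h p) = Complex.exp (g p) := by
    intro p hp
    rw [hhe p hp.2, hge p hp.1]
  have hκe : ∀ p ∈ B, Complex.exp (κ p) = 1 := by
    intro p hp
    rw [hκ, Complex.exp_sub, hexpB p hp, div_self (Complex.exp_ne_zero _)]
  have hκconst : ∀ C ⊆ B, IsPreconnected C → ∀ p ∈ C, ∀ q ∈ C, κ p = κ q :=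
    fun C hCB hC p hp q hq => hC.sub_eq_of_exp_eq (hhB.mono hCB) (hgB.mono hCB)
      (fun x hx => hexpB x (hCB hx)) hp hq
  have hmemB : ∀ ξ, ξ ∉ K → ∀ p ∈ boundaryFiber D φ ξ, p ∈ closure X → p ∈ B :=
    fun ξ hξ p hp hpX => ⟨hball (hXa hpX), hoff ξ hξ p hp⟩
  have hsubX : ∀ ξ ∈ sphere z₀ r, ξ ∉ Z₀ → boundaryFiber D φ ξ ⊆ X := fun ξ hξ hξZ =>
    subset_biUnion_of_mem (u := boundaryFiber D φ) (show ξ ∈ sphere z₀ r \ Z₀ from ⟨hξ, hξZ⟩)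
  have hZfib : ∀ ξ ∈ Z₀, boundaryFiber D φ ξ = boundaryFiber D φ z₀ := fun ξ hξ =>
    boundaryFiber_congr (connectedComponentIn_subset _ _ hξ) hz₀ (connectedComponentIn_eq hξ).symm
  have hwd : ∀ ξ ∈ sphere z₀ r, ξ ∉ K → ∀ p ∈ boundaryFiber D φ ξ, p ∈ closure X →
      ∀ q ∈ boundaryFiber D φ ξ, q ∈ closure X → κ p = κ q := by
    intro ξ hξ hξK p hp hpX q hq hqX
    by_cases hξZ : ξ ∈ Z₀
    · rw [hZfib ξ hξZ] at hp hq
      obtain ⟨C, hCP, hC, hpC, hqC, hCb⟩ := hloc p hp q hq (hXcl p hpX q hqX)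
      refine hκconst C (fun x hx => ⟨?_, ?_⟩) hC p hpC q hqC
      · have h1 := hCb hx
        have h2 := hXa hpX
        rw [mem_ball] at *
        linarith [dist_triangle x p a]
      · exact hoff z₀ (fun hK => hz₀ (hKD hK)) x (hCP hx)
    · refine hκconst _ (fun x hx => hmemB ξ hξK x hx (subset_closure (hsubX ξ hξ hξZ hx)))
        (hc.isPreconnected_boundaryFiber hD ξ) p hp q hq
  classical
  let κ' : ℂ → ℂ := fun ξ =>
    if hξ : (boundaryFiber D φ ξ ∩ closure X).Nonempty then κ hξ.some else 0
  have hκ' : ∀ ξ ∈ sphere z₀ r, ξ ∉ K → ∀ p ∈ boundaryFiber D φ ξ, p ∈ closure X →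
      κ' ξ = κ p := by
    intro ξ hξ hξK p hp hpX
    have hne : (boundaryFiber D φ ξ ∩ closure X).Nonempty := ⟨p, hp, hpX⟩
    simp only [κ', hne, dif_pos]
    exact hwd ξ hξ hξK _ hne.some_mem.1 hne.some_mem.2 p hp hpX
  have hκ'0 : ∀ ξ, ¬ (boundaryFiber D φ ξ ∩ closure X).Nonempty → κ' ξ = 0 := by
    intro ξ hξ
    simp only [κ', hξ, dif_neg, not_false_eq_true]
  have hκ'e : ∀ ξ ∈ sphere z₀ r, ξ ∉ K → Complex.exp (κ' ξ) = 1 := by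
    intro ξ hξ hξK
    by_cases hne : (boundaryFiber D φ ξ ∩ closure X).Nonempty
    · obtain ⟨p, hp, hpX⟩ := hne
      rw [hκ' ξ hξ hξK p hp hpX]
      exact hκe p (hmemB ξ hξK p hp hpX)
    · rw [hκ'0 ξ hne, Complex.exp_zero]
  have hlc : ∀ ξ ∈ sphere z₀ r, ξ ∉ D → ∀ᶠ ξ' in 𝓝[sphere z₀ r] ξ, κ' ξ' = κ' ξ := by
    intro ξ hξ hξD
    have hξK : ξ ∉ K := fun hK => hξD (hKD hK)
    by_cases hne : (boundaryFiber D φ ξ ∩ closure X).Nonempty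
    · set O := B ∩ κ ⁻¹' ball (κ' ξ) 1
      have hO : IsOpen O := hκc.isOpen_inter_preimage hBo isOpen_ball
      have hcl := hc.isClosed_boundaryFiber_preimage hD (A := closure X \ O)
        (isClosed_closure.sdiff hO)
      have hn : ξ ∉ {ξ | (boundaryFiber D φ ξ ∩ (closure X \ O)).Nonempty} := by
        rintro ⟨p, hp, hpX, hpO⟩
        refine hpO ⟨hmemB ξ hξK p hp hpX, ?_⟩
        rw [mem_preimage, hκ' ξ hξ hξK p hp hpX]
        exact mem_ball_self one_pos
      have hne' : ∀ᶠ ξ' in 𝓝[sphere z₀ r] ξ, (boundaryFiber D φ ξ' ∩ closure X).Nonempty := by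
        by_cases hξZ : ξ ∈ Z₀
        · filter_upwards [self_mem_nhdsWithin] with x hx
          by_cases hxZ : x ∈ Z₀
          · rwa [hZfib x hxZ, ← hZfib ξ hξZ]
          · obtain ⟨p, hp⟩ := hc.boundaryFiber_nonempty hD x
            exact ⟨p, hp, subset_closure (hsubX x hx hxZ hp)⟩
        · filter_upwards [self_mem_nhdsWithin, mem_nhdsWithin_of_mem_nhds
            ((hD.isClosed_component hz₀).isOpen_compl.mem_nhds hξZ)] with x hx hxZ
          obtain ⟨p, hp⟩ := hc.boundaryFiber_nonempty hD x
          exact ⟨p, hp, subset_closure (hsubX x hx hxZ hp)⟩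
      filter_upwards [self_mem_nhdsWithin, hne',
        mem_nhdsWithin_of_mem_nhds (hcl.isOpen_compl.mem_nhds hn),
        mem_nhdsWithin_of_mem_nhds (hKc.isClosed.isOpen_compl.mem_nhds hξK)] with x hx hxne hxO hxK
      obtain ⟨p, hp, hpX⟩ := hxne
      have hpO : p ∈ O := by
        by_contra hpO
        exact hxO ⟨p, hp, hpX, hpO⟩
      have e := hκ' x hx hxK p hp hpX
      refine Complex.eq_of_exp_eq_of_norm_lt ?_ ?_
      · rw [hκ'e x hx hxK, hκ'e ξ hξ hξK]
      · rw [e, ← dist_eq_norm]; exact hpO.2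
    · have hcl := hc.isClosed_boundaryFiber_preimage hD (A := closure X) isClosed_closure
      filter_upwards [mem_nhdsWithin_of_mem_nhds (hcl.isOpen_compl.mem_nhds hne)] with x hx
      rw [hκ'0 ξ hne, hκ'0 x hx]
  let L : ℂ → ℂ := fun ξ => if ξ ∈ D then g (φ ξ) - q ξ else l ξ - κ' ξ
  have hsphD : ∀ ξ ∈ sphere z₀ r, ξ ∈ D → φ ξ ∈ X := by
    intro ξ hξ hξD
    refine hsubX ξ hξ (fun hZ => connectedComponentIn_subset _ _ hZ hξD) ?_
    rw [boundaryFiber_of_mem hξD]; rfl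
  have hLeq : ∀ ξ ∈ sphere z₀ r, ξ ∉ K → L ξ = l ξ - κ' ξ := by
    intro ξ hξ hξK
    by_cases hξD : ξ ∈ D
    · simp only [L, hξD, if_true]
      rw [hκ' ξ hξ hξK (φ ξ) (by rw [boundaryFiber_of_mem hξD]; rfl)
        (subset_closure (hsphD ξ hξ hξD)), hκ]
      simp only
      rw [hhq ξ ⟨hξD, hξK⟩]; ring
    · simp only [L, hξD, if_false]
  refine not_exists_log_frontier (G := ball z₀ r) isBounded_ball hzr (z' := z') ?_ (L := L) ?_ ?_
  · rwa [closure_ball z₀ hr.ne']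
  · rw [frontier_ball z₀ hr.ne']
    intro ξ hξ
    by_cases hξD : ξ ∈ D
    · have hDn := hc.isOpen_source.mem_nhds hξD
      have e : L =ᶠ[𝓝 ξ] fun ξ => g (φ ξ) - q ξ := by
        filter_upwards [hDn] with x hx
        simp only [L, hx, if_true]
      refine (ContinuousAt.congr ?_ e.symm).continuousWithinAt
      have h1 : ContinuousAt g (φ ξ) := hg.continuousAt
        (isOpen_ball.mem_nhds (hball (hXa (subset_closure (hsphD ξ hξ hξD)))))
      exact (h1.comp (hc.continuousOn.continuousAt hDn)).sub (hq.continuousAt hDn)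
    · have hξK : ξ ∉ K := fun hK => hξD (hKD hK)
      have hKn := hKc.isClosed.isOpen_compl.mem_nhds hξK
      have e : L =ᶠ[𝓝[sphere z₀ r] ξ] fun x => l x - κ' ξ := by
        filter_upwards [self_mem_nhdsWithin, hlc ξ hξ hξD, mem_nhdsWithin_of_mem_nhds hKn]
          with x hx h1 hxK
        rw [hLeq x hx hxK, h1]
      refine ContinuousWithinAt.congr_of_eventuallyEq ?_ e (hLeq ξ hξ hξK)
      exact ((hl.continuousAt hKn).sub continuousAt_const).continuousWithinAt
  · rw [frontier_ball z₀ hr.ne']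
    intro ξ hξ
    by_cases hξD : ξ ∈ D
    · have hn1 : ξ ≠ z := by
        rintro rfl; rw [mem_sphere] at hξ; rw [mem_ball] at hzr; linarith
      have hn2 : ξ ≠ z' := by
        rintro rfl; exact hzr' (sphere_subset_closedBall hξ)
      simp only [L, hξD, if_true]
      rw [Complex.exp_sub, hge _ (hball (hXa (subset_closure (hsphD ξ hξ hξD)))),
        ← hqe ξ hξD hn1 hn2]
      field_simp [Complex.exp_ne_zero]
    · have hξK : ξ ∉ K := fun hK => hξD (hKD hK)
      rw [hLeq ξ hξ hξK, Complex.exp_sub, hκ'e ξ hξ hξK, div_one, hle ξ hξK]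

end BoundedConformalPair

/-- The union of the boundary fibers over the part of a circle about `z` lying off the
complementary component of `z`. -/
def circleFiber (D : Set ℂ) (φ : ℂ → ℂ) (z : ℂ) (r : ℝ) : Set ℂ :=
  ⋃ ξ ∈ sphere z r \ connectedComponentIn Dᶜ z, boundaryFiber D φ ξ

namespace BoundedConformalPair

variable {D Ω : Set ℂ} {φ ψ : ℂ → ℂ}

theorem circleFiber_nonempty (hc : BoundedConformalPair D Ω φ ψ) {z₀ z₁ : ℂ} {r : ℝ}
    (hz₀ : z₀ ∈ frontier D) (hr : 0 < r) (hz₁ : z₁ ∈ D) (hrz : r < dist z₁ z₀) :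
    (circleFiber D φ z₀ r).Nonempty := by
  obtain ⟨z, hz, hzD⟩ := mem_closure_iff.1 (frontier_subset_closure hz₀) _ isOpen_ball
    (mem_ball_self hr)
  obtain ⟨u, hu, huf⟩ := hc.source.2.2.isPreconnected.exists_mem_frontier hzD hz hz₁
    (show z₁ ∉ ball z₀ r by rw [mem_ball]; linarith)
  rw [frontier_ball z₀ hr.ne'] at huf
  refine ⟨φ u, mem_biUnion ⟨huf, fun h => connectedComponentIn_subset _ _ h hu⟩ ?_⟩
  rw [boundaryFiber_of_mem hu]; rfl

theorem tendsto_of_small_circleFiber (hc : BoundedConformalPair D Ω φ ψ) (hD : IsCircleDomain D)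
    (hP : ∀ x ∈ frontier Ω, LocallyConnectedSpace ↥(connectedComponentIn (frontier Ω) x))
    {z₀ : ℂ} (hz₀ : z₀ ∈ frontier D)
    (hsmall : ∀ η > 0, ∀ δ > 0, ∃ r > 0, r < δ ∧
      ∀ p ∈ circleFiber D φ z₀ r, ∀ q ∈ circleFiber D φ z₀ r, dist p q ≤ η) :
    ∃ p, Tendsto φ (𝓝[D] z₀) (𝓝 p) := by
  have hz₀D := hD.notMem_of_frontier hz₀
  obtain ⟨p₀, hp₀⟩ := hc.exists_mem_graphClosure (frontier_subset_closure hz₀)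
  obtain ⟨z₁, hz₁⟩ := hc.source.1
  have hz₁₀ : 0 < dist z₁ z₀ := dist_pos.2 fun h => hz₀D (h ▸ hz₁)
  obtain ⟨z₂, hz₂b, hz₂⟩ := mem_closure_iff.1 (frontier_subset_closure hz₀) _ isOpen_ball
    (mem_ball_self hz₁₀)
  have hz₂₀ : 0 < dist z₂ z₀ := dist_pos.2 fun h => hz₀D (h ▸ hz₂)
  have hne : φ z₁ ≠ φ z₂ := by
    intro h
    have := hc.map.2.injOn hz₁ hz₂ h
    rw [← this, mem_ball] at hz₂b
    exact lt_irrefl _ hz₂b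
  have hd : 0 < dist (φ z₁) (φ z₂) := dist_pos.2 hne
  have hcomp : IsCompact (boundaryFiber D φ z₀) := by
    refine hc.target_bdd.isCompact_closure.of_isClosed_subset ?_
      (hc.boundaryFiber_subset_closure z₀)
    exact (hc.isClosed_boundaryFiber_graph hD).preimage (Continuous.prodMk_right z₀)
  have hp₀' := hc.mem_boundaryFiber_of_graph hp₀
  have hlcs : LocallyConnectedSpace (boundaryFiber D φ z₀) := by
    rw [hc.boundaryFiber_eq_component hD hz₀D hp₀']
    exact hP p₀ (hc.mem_frontier_of_mem_boundaryFiber hz₀D hp₀')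
  refine ⟨p₀, Metric.tendsto_nhdsWithin_nhds.2 fun ε' hε' => ?_⟩
  set ε := min (ε' / 2) (dist (φ z₁) (φ z₂) / 2) with hεdef
  have hε : 0 < ε := by positivity
  obtain ⟨η, hη, hloc⟩ := exists_uniform_locallyConnected hcomp (half_pos hε)
  have hη' : min (η / 2) (ε / 4) < η := (min_le_left _ _).trans_lt (by linarith)
  obtain ⟨r, hr, hrδ, hX⟩ := hsmall (min (η / 2) (ε / 4)) (by positivity)
    (min (dist z₁ z₀) (dist z₂ z₀)) (by positivity)
  have hr1 : r < dist z₁ z₀ := hrδ.trans_le (min_le_left _ _)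
  have hr2 : r < dist z₂ z₀ := hrδ.trans_le (min_le_right _ _)
  obtain ⟨a, ha⟩ := hc.circleFiber_nonempty hz₀ hr hz₁ hr1
  rcases hc.image_subset_ball_of_small hD hz₀D hr hε
    ((min_le_right _ _).trans_lt (by linarith : ε / 4 < ε / 2))
    (fun p hp q hq hpq => hloc p hp q hq (hpq.trans_lt hη')) hX ha with h | h
  · refine ⟨r, hr, fun {x} hx hxr => ?_⟩
    have h1 := h x hx hxr
    obtain ⟨y, hyD, hyr, hyp⟩ := exists_mem_ball_of_mem_graphClosure hp₀
      (ε := (ε - dist (φ x) a) ) (by rw [mem_ball] at h1; linarith) isOpen_ball (mem_ball_self hr)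
    have h2 := h y hyD hyr
    rw [mem_ball] at h1 h2 hyp
    have h3 : ε ≤ ε' / 2 := min_le_left _ _
    have h4 := dist_triangle (φ x) a p₀
    have h5 := dist_triangle_left a p₀ (φ y)
    linarith
  · exfalso
    have h1 := h z₁ hz₁ (by rw [mem_closedBall]; linarith)
    have h2 := h z₂ hz₂ (by rw [mem_closedBall]; linarith)
    rw [mem_ball] at h1 h2
    have h3 : ε ≤ dist (φ z₁) (φ z₂) / 2 := min_le_right _ _
    linarith [dist_triangle_right (φ z₁) (φ z₂) a]

theorem exists_extension (hc : BoundedConformalPair D Ω φ ψ)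
    (hlim : ∀ z₀ ∈ frontier D, ∃ p, Tendsto φ (𝓝[D] z₀) (𝓝 p)) :
    ∃ φb : ℂ → ℂ, ExtendsContinuously φ φb D Ω := by
  have hlim' : ∀ z ∈ closure D, ∃ p, Tendsto φ (𝓝[D] z) (𝓝 p) := by
    intro z hz
    by_cases hzD : z ∈ D
    · exact ⟨φ z, hc.continuousOn z hzD⟩
    · exact hlim z (by rw [hc.isOpen_source.frontier_eq]; exact ⟨hz, hzD⟩)
  refine ⟨extendFrom D φ, continuousOn_extendFrom Subset.rfl hlim', ?_, ?_⟩
  · intro z hz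
    exact extendFrom_eq (subset_closure hz) (hc.continuousOn z hz)
  · intro z hz
    obtain ⟨p, hp⟩ := hlim' z hz
    rw [extendFrom_eq hz hp]
    have : (𝓝[D] z).NeBot := mem_closure_iff_nhdsWithin_neBot.1 hz
    refine mem_closure_of_tendsto hp ?_
    filter_upwards [self_mem_nhdsWithin] with x hx
    exact hc.mapsTo hx

end BoundedConformalPair

/-- The part of a circle in an open half plane is connected. -/
theorem isPreconnected_sphere_inter_halfPlane (z v : ℂ) {r : ℝ} (hr : 0 < r) (b : ℝ) :
    IsPreconnected {ξ ∈ sphere z r | b < (starRingEnd ℂ v * (ξ - z)).re} := by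
  set T : Set ℝ := {θ ∈ Icc (-Real.pi) Real.pi | b < r * ‖v‖ * Real.cos θ} with hT
  have hTc : IsPreconnected T := by
    refine Set.OrdConnected.isPreconnected (ordConnected_iff.2 ?_)
    rintro x ⟨hx, hxb⟩ y ⟨hy, hyb⟩ - θ hθ
    have hθπ : |θ| ≤ Real.pi := abs_le.2 ⟨hx.1.trans hθ.1, hθ.2.trans hy.2⟩
    refine ⟨abs_le.1 hθπ, ?_⟩
    have hv : 0 ≤ r * ‖v‖ := by positivity
    have key : ∀ t, |t| ≤ Real.pi → |θ| ≤ |t| → b < r * ‖v‖ * Real.cos t →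
        b < r * ‖v‖ * Real.cos θ := by
      intro t ht hθt hb
      refine hb.trans_le (mul_le_mul_of_nonneg_left ?_ hv)
      rw [← Real.cos_abs t, ← Real.cos_abs θ]
      exact Real.cos_le_cos_of_nonneg_of_le_pi (abs_nonneg _) ht hθt
    rcases abs_le_max_abs_abs hθ.1 hθ.2 |> le_max_iff.1 with h | h
    · exact key x (abs_le.2 hx) h hxb
    · exact key y (abs_le.2 hy) h hyb
  have hre : ∀ θ : ℝ, (starRingEnd ℂ v * (r * Complex.exp ((v.arg + θ : ℝ) * Complex.I))).re
      = r * ‖v‖ * Real.cos θ := by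
    intro θ
    have hv : starRingEnd ℂ v = ‖v‖ * Complex.exp (-(v.arg * Complex.I)) := by
      conv_lhs => rw [← Complex.norm_mul_exp_arg_mul_I v]
      rw [map_mul, Complex.conj_ofReal, ← Complex.exp_conj, map_mul, Complex.conj_ofReal,
        Complex.conj_I, mul_neg]
    have : starRingEnd ℂ v * (r * Complex.exp ((v.arg + θ : ℝ) * Complex.I))
        = ((r * ‖v‖ : ℝ) : ℂ) * Complex.exp (θ * Complex.I) := by
      rw [hv]
      push_cast
      rw [add_mul, Complex.exp_add, Complex.exp_neg]
      field_simp [Complex.exp_ne_zero]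
    rw [this, Complex.re_ofReal_mul, Complex.exp_ofReal_mul_I_re]
  have e : {ξ ∈ sphere z r | b < (starRingEnd ℂ v * (ξ - z)).re} =
      (fun θ : ℝ => z + r * Complex.exp ((v.arg + θ : ℝ) * Complex.I)) '' T := by
    ext ξ
    constructor
    · rintro ⟨hξ, hb⟩
      set θ := ((ξ - z) * Complex.exp (-(v.arg * Complex.I))).arg with hθ
      have h1 : ‖(ξ - z) * Complex.exp (-(v.arg * Complex.I))‖ = r := by
        rw [norm_mul, ← neg_mul, ← Complex.ofReal_neg, Complex.norm_exp_ofReal_mul_I, mul_one]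
        simpa [dist_eq_norm] using hξ
      have h2 := Complex.norm_mul_exp_arg_mul_I ((ξ - z) * Complex.exp (-(v.arg * Complex.I)))
      rw [h1, ← hθ] at h2
      have h3 : z + r * Complex.exp ((v.arg + θ : ℝ) * Complex.I) = ξ := by
        push_cast
        rw [add_mul, Complex.exp_add, mul_left_comm, h2, Complex.exp_neg]
        field_simp [Complex.exp_ne_zero]
        ring
      refine ⟨θ, ⟨⟨(Complex.neg_pi_lt_arg _).le, Complex.arg_le_pi _⟩, ?_⟩, h3⟩
      rw [← hre, show (r : ℂ) * Complex.exp ((v.arg + θ : ℝ) * Complex.I) = ξ - z by rw [← h3]; ring]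
      exact hb
    · rintro ⟨θ, ⟨-, hb⟩, rfl⟩
      refine ⟨?_, ?_⟩
      · rw [mem_sphere, dist_eq_norm, add_sub_cancel_left, norm_mul,
          Complex.norm_exp_ofReal_mul_I, mul_one, Complex.norm_real, Real.norm_of_nonneg hr.le]
      · rw [add_sub_cancel_left, hre]; exact hb
  rw [e]
  exact hTc.image _ (by fun_prop)

theorem norm_add_sq_eq (v w : ℂ) :
    ‖v + w‖ ^ 2 = ‖v‖ ^ 2 + ‖w‖ ^ 2 + 2 * (starRingEnd ℂ v * w).re := by
  simp only [← Complex.normSq_eq_norm_sq, Complex.normSq_apply, Complex.add_re, Complex.add_im,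
    Complex.mul_re, Complex.conj_re, Complex.conj_im]
  ring

namespace IsCircleDomain

variable {D : Set ℂ}

theorem isPreconnected_sphere_sdiff_component (hD : IsCircleDomain D) {z : ℂ}
    (hz : z ∈ frontier D) {r : ℝ} (hr : 0 < r) :
    IsPreconnected (sphere z r \ connectedComponentIn Dᶜ z) := by
  have hzD := hD.notMem_of_frontier hz
  have hzf : z ∈ frontier (connectedComponentIn Dᶜ z) := by
    rw [hD.frontier_eq hzD]; exact ⟨mem_connectedComponentIn hzD, hz⟩
  have hdist : ∀ c ξ : ℂ, ξ ∈ sphere z r → ∀ R, ‖z - c‖ = R →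
      ‖ξ - c‖ ^ 2 = R ^ 2 + r ^ 2 + 2 * (starRingEnd ℂ (z - c) * (ξ - z)).re := by
    intro c ξ hξ R hR
    rw [mem_sphere, dist_eq_norm] at hξ
    rw [← hξ, ← hR, ← norm_add_sq_eq]
    ring_nf
  rcases hD.component_cases hzD with h | ⟨c, R, hR, h⟩ | ⟨c, R, hR, h⟩
  · rw [h, sdiff_singleton_eq_self]
    · exact isPreconnected_sphere (by simp [Complex.rank_real_complex]) z r
    · simp [hr.ne]
  · rw [h, frontier_closedBall c hR.ne', mem_sphere, dist_eq_norm] at hzf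
    convert isPreconnected_sphere_inter_halfPlane z (z - c) hr (-(r ^ 2 / 2)) using 1
    rw [h]
    ext ξ
    refine and_congr_right fun hξ => ?_
    rw [mem_closedBall, not_le, dist_eq_norm, ← sq_lt_sq₀ hR.le (norm_nonneg _),
      hdist c ξ hξ R hzf]
    constructor <;> intro h <;> linarith
  · rw [h, frontier_compl, frontier_ball c hR.ne', mem_sphere, dist_eq_norm] at hzf
    convert isPreconnected_sphere_inter_halfPlane z (-(z - c)) hr (r ^ 2 / 2) using 1
    rw [h]
    ext ξ
    refine and_congr_right fun hξ => ?_
    rw [notMem_compl_iff, mem_ball, dist_eq_norm, ← sq_lt_sq₀ (norm_nonneg _) hR.le,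
      hdist c ξ hξ R hzf, map_neg, neg_mul, Complex.neg_re]
    constructor <;> intro h <;> linarith

end IsCircleDomain

namespace BoundedConformalPair

variable {D Ω : Set ℂ} {φ ψ : ℂ → ℂ}

theorem isPreconnected_circleFiber (hc : BoundedConformalPair D Ω φ ψ) (hD : IsCircleDomain D)
    {z₀ : ℂ} (hz₀ : z₀ ∈ frontier D) {r : ℝ} (hr : 0 < r) :
    IsPreconnected (circleFiber D φ z₀ r) :=
  hc.isPreconnected_biUnion_boundaryFiber hD (hD.isPreconnected_sphere_sdiff_component hz₀ hr)

end BoundedConformalPair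

open scoped ENNReal

theorem exists_mul_le_of_lintegral_ne_top {F : ℝ → ℝ≥0∞} (hF : ∫⁻ r in Ioi 0, F r ≠ ⊤)
    {N : Set ℝ} (hN : N.Countable) {δ : ℝ} (hδ : 0 < δ) {η : ℝ≥0∞} (hη : η ≠ 0) :
    ∃ r ∈ Ioo 0 δ, r ∉ N ∧ ENNReal.ofReal r * F r ≤ η := by
  by_contra! H
  have h1 : ∫⁻ r in Ioo 0 δ, min η 1 * ENNReal.ofReal r⁻¹ ≠ ⊤ := by
    refine ne_top_of_le_ne_top hF ?_
    refine (lintegral_mono_ae (g := F) ?_).trans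
      (lintegral_mono_set (μ := volume) Ioo_subset_Ioi_self)
    have hN0 : ∀ᵐ r ∂(volume.restrict (Ioo 0 δ)), r ∉ N :=
      ae_restrict_of_ae (compl_mem_ae_iff.2 (hN.measure_zero volume))
    filter_upwards [ae_restrict_mem measurableSet_Ioo, hN0] with r hr hrN
    have hr0 : ENNReal.ofReal r ≠ 0 := by simpa using hr.1
    rw [ENNReal.ofReal_inv_of_pos hr.1, ← div_eq_mul_inv]
    refine ENNReal.div_le_of_le_mul ?_
    rw [mul_comm]
    exact (min_le_left _ _).trans (H r hr hrN).le
  rw [lintegral_const_mul' _ _ (by simp)] at h1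
  have h2 : ∫⁻ r in Ioo 0 δ, ENNReal.ofReal r⁻¹ ≠ ⊤ := fun h => h1 (by
    rw [h, ENNReal.mul_top (by simpa using hη)])
  have h3 : IntervalIntegrable (fun x : ℝ => x⁻¹) volume 0 δ := by
    rw [intervalIntegrable_iff_integrableOn_Ioo_of_le hδ.le]
    refine ⟨by fun_prop, ?_⟩
    rw [hasFiniteIntegral_iff_ofReal]
    · exact h2.lt_top
    · filter_upwards [ae_restrict_mem measurableSet_Ioo] with r hr using inv_nonneg.2 hr.1.le
  rw [intervalIntegrable_inv_iff] at h3
  rcases h3 with h | h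
  · exact hδ.ne h
  · exact h left_mem_uIcc

theorem lintegral_enorm_deriv_sq {D : Set ℂ} {φ : ℂ → ℂ} (hDo : IsOpen D)
    (hφ : DifferentiableOn ℂ φ D) (hinj : InjOn φ D) :
    ∫⁻ z, D.indicator (fun z => ‖deriv φ z‖ₑ) z ^ 2 = volume (φ '' D) := by
  have hd : ∀ z ∈ D, HasFDerivWithinAt φ
      ((ContinuousLinearMap.toSpanSingleton ℂ (deriv φ z)).restrictScalars ℝ) D z := fun z hz =>
    ((hφ.differentiableAt (hDo.mem_nhds hz)).hasDerivAt.hasFDerivAt.restrictScalars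
      ℝ).hasFDerivWithinAt
  rw [← lintegral_abs_det_fderiv_eq_addHaar_image volume hDo.measurableSet hd hinj,
    ← lintegral_indicator hDo.measurableSet]
  congr 1 with z
  by_cases hz : z ∈ D
  · simp only [indicator_of_mem hz]
    have : ((ContinuousLinearMap.toSpanSingleton ℂ (deriv φ z)).restrictScalars ℝ).det
        = ‖deriv φ z‖ ^ 2 := by
      rw [ContinuousLinearMap.det, ContinuousLinearMap.coe_restrictScalars,
        LinearMap.det_restrictScalars]
      have : LinearMap.det (ContinuousLinearMap.toSpanSingleton ℂ (deriv φ z) : ℂ →ₗ[ℂ] ℂ)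
        = deriv φ z := ContinuousLinearMap.det_toSpanSingleton _
      rw [this, Algebra.norm_complex_eq]
      simp [Complex.normSq_eq_norm_sq]
    rw [this, abs_of_nonneg (by positivity), ENNReal.ofReal_pow (by positivity),
      ofReal_norm]
  · simp [indicator_of_notMem hz]

theorem lintegral_circleMap {g : ℂ → ℝ≥0∞} (hg : Measurable g) (z₀ : ℂ) :
    ∫⁻ r in Ioi 0, ∫⁻ θ in Ioo (-Real.pi) Real.pi, ENNReal.ofReal r * g (circleMap z₀ r θ)
      = ∫⁻ z, g z := by
  rw [← lintegral_add_left_eq_self g z₀, ← Complex.lintegral_comp_polarCoord_symm]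
  have hm : Measurable fun p : ℝ × ℝ => ENNReal.ofReal p.1 * g (circleMap z₀ p.1 p.2) := by
    have : Measurable fun p : ℝ × ℝ => circleMap z₀ p.1 p.2 := by
      unfold circleMap; fun_prop
    fun_prop
  rw [show polarCoord.target = Ioi (0:ℝ) ×ˢ Ioo (-Real.pi) Real.pi from rfl,
    Measure.volume_eq_prod, ← Measure.prod_restrict, lintegral_prod]
  · simp only [Complex.polarCoord_symm_apply, circleMap, smul_eq_mul, Complex.exp_mul_I,
      Complex.ofReal_cos, Complex.ofReal_sin]
  · simpa only [Complex.polarCoord_symm_apply, circleMap, smul_eq_mul, Complex.exp_mul_I,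
      Complex.ofReal_cos, Complex.ofReal_sin] using hm.aemeasurable

theorem volume_image_circle_le {D : Set ℂ} {φ : ℂ → ℂ} (hDo : IsOpen D)
    (hφ : DifferentiableOn ℂ φ D) (f : ℂ →L[ℝ] ℝ) (hf : ‖f‖ ≤ 1) (z₀ : ℂ) {r : ℝ} (hr : 0 < r) :
    volume (f '' (φ '' (D ∩ sphere z₀ r))) ≤ ∫⁻ θ in Ioo (-Real.pi) Real.pi,
      ENNReal.ofReal r * D.indicator (fun z => ‖deriv φ z‖ₑ) (circleMap z₀ r θ) := by
  set S : Set ℝ := Ioo (-Real.pi) Real.pi ∩ circleMap z₀ r ⁻¹' D with hS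
  have hSm : MeasurableSet S :=
    measurableSet_Ioo.inter ((hDo.preimage (continuous_circleMap z₀ r)).measurableSet)
  set u : ℝ → ℝ := fun θ => f (φ (circleMap z₀ r θ)) with hu
  have hd : ∀ θ ∈ S, HasDerivAt u (f (deriv φ (circleMap z₀ r θ) *
      (circleMap 0 r θ * Complex.I))) θ := by
    intro θ hθ
    have h1 := (hφ.differentiableAt (hDo.mem_nhds hθ.2)).hasDerivAt.comp θ
      (hasDerivAt_circleMap z₀ r θ)
    exact f.hasFDerivAt.comp_hasDerivAt θ h1
  have hsub : f '' (φ '' (D ∩ sphere z₀ r)) ⊆ u '' S ∪ {u Real.pi} := by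
    rintro _ ⟨_, ⟨z, ⟨hzD, hz⟩, rfl⟩, rfl⟩
    have hz' : circleMap z₀ r (z - z₀).arg = z := by
      rw [mem_sphere, dist_eq_norm] at hz
      rw [circleMap, ← hz, Complex.norm_mul_exp_arg_mul_I, add_sub_cancel]
    rcases (Complex.arg_le_pi (z - z₀)).lt_or_eq with h | h
    · exact Or.inl ⟨(z - z₀).arg, ⟨⟨Complex.neg_pi_lt_arg _, h⟩, by simpa [hz'] using hzD⟩,
        by simp only [hu, hz']⟩
    · refine Or.inr ?_
      rw [mem_singleton_iff, hu, ← h]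
      simp only [hz']
  calc volume (f '' (φ '' (D ∩ sphere z₀ r))) ≤ volume (u '' S) + volume {u Real.pi} :=
        (measure_mono hsub).trans (measure_union_le _ _)
    _ = volume (u '' S) := by simp
    _ ≤ ∫⁻ θ in S, ENNReal.ofReal |(ContinuousLinearMap.toSpanSingleton ℝ
          (f (deriv φ (circleMap z₀ r θ) * (circleMap 0 r θ * Complex.I)))).det| :=
        addHaar_image_le_lintegral_abs_det_fderiv volume hSm
          fun θ hθ => (hd θ hθ).hasFDerivAt.hasFDerivWithinAt
    _ ≤ ∫⁻ θ in S, ENNReal.ofReal r *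
          D.indicator (fun z => ‖deriv φ z‖ₑ) (circleMap z₀ r θ) := by
        refine setLIntegral_mono' hSm fun θ hθ => ?_
        rw [indicator_of_mem (show circleMap z₀ r θ ∈ D from hθ.2),
          ContinuousLinearMap.det_toSpanSingleton, ← ofReal_norm,
          ← ENNReal.ofReal_mul hr.le]
        refine ENNReal.ofReal_le_ofReal ?_
        rw [← Real.norm_eq_abs]
        refine (f.le_of_opNorm_le hf _).trans_eq ?_
        simp [abs_of_pos hr, mul_comm]
    _ ≤ _ := lintegral_mono_set inter_subset_left

theorem exists_small_volume_image_circle {D : Set ℂ} {φ : ℂ → ℂ} (hDo : IsOpen D)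
    (hφ : DifferentiableOn ℂ φ D) (hinj : InjOn φ D) (hvol : volume (φ '' D) ≠ ⊤) (z₀ : ℂ)
    {N : Set ℝ} (hN : N.Countable) {δ : ℝ} (hδ : 0 < δ) {η : ℝ≥0∞} (hη : η ≠ 0) :
    ∃ r ∈ Ioo 0 δ, r ∉ N ∧ ∀ f : ℂ →L[ℝ] ℝ, ‖f‖ ≤ 1 →
      volume (f '' (φ '' (D ∩ sphere z₀ r))) ≤ η := by
  set g : ℂ → ℝ≥0∞ := D.indicator fun z => ‖deriv φ z‖ₑ with hg
  have hgm : Measurable g := (measurable_deriv φ).enorm.indicator hDo.measurableSet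
  have hI := lintegral_circleMap (hgm.pow_const 2) z₀
  rw [hg, lintegral_enorm_deriv_sq hDo hφ hinj, ← hg] at hI
  rw [← hI] at hvol
  obtain ⟨c, hc0, hc⟩ : ∃ c : ℝ≥0∞, 0 < c ∧ c * volume (Ioo (-Real.pi) Real.pi) < η / 2 := by
    have hV : volume (Ioo (-Real.pi) Real.pi) ≠ ⊤ := by simp
    have hV0 : volume (Ioo (-Real.pi) Real.pi) ≠ 0 := by
      simp [Real.pi_pos]
    obtain ⟨c, hc0, hc⟩ := exists_between (show 0 < η / 2 / volume (Ioo (-Real.pi) Real.pi) from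
      ENNReal.div_pos (by simpa using hη) hV)
    exact ⟨c, hc0, (ENNReal.lt_div_iff_mul_lt (Or.inl hV0) (Or.inl hV)).1 hc⟩
  have hct : c ≠ ⊤ := by
    rintro rfl
    rw [ENNReal.top_mul (by simp [Real.pi_pos])] at hc
    exact not_top_lt hc
  obtain ⟨r, hr, hrN, hle⟩ := exists_mul_le_of_lintegral_ne_top hvol hN hδ
    (show c * (η / 2) ≠ 0 by simp [hc0.ne', hη])
  refine ⟨r, hr, hrN, fun f hf => (volume_image_circle_le hDo hφ f hf z₀ hr.1).trans ?_⟩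
  have hpt : ∀ x : ℝ≥0∞, x ≤ c + x ^ 2 / c := fun x => by
    rcases le_total x c with h | h
    · exact h.trans le_self_add
    · refine le_trans ?_ le_add_self
      rw [ENNReal.le_div_iff_mul_le (Or.inl hc0.ne') (Or.inl hct), sq]
      gcongr
  calc ∫⁻ θ in Ioo (-Real.pi) Real.pi, ENNReal.ofReal r * g (circleMap z₀ r θ)
      ≤ ∫⁻ θ in Ioo (-Real.pi) Real.pi,
          (c + (ENNReal.ofReal r * g (circleMap z₀ r θ)) ^ 2 / c) :=
        lintegral_mono fun θ => hpt _
    _ = c * volume (Ioo (-Real.pi) Real.pi) + (ENNReal.ofReal r *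
          ∫⁻ θ in Ioo (-Real.pi) Real.pi, ENNReal.ofReal r * g (circleMap z₀ r θ) ^ 2) / c := by
        rw [lintegral_add_left measurable_const, setLIntegral_const]
        congr 1
        simp only [div_eq_mul_inv]
        rw [lintegral_mul_const' _ _ (by simpa using hc0.ne'),
          ← lintegral_const_mul' _ _ ENNReal.ofReal_ne_top]
        congr 2 with θ
        ring
    _ ≤ η / 2 + η / 2 := by
        refine add_le_add hc.le (ENNReal.div_le_of_le_mul ?_)
        rwa [mul_comm (η / 2)]
    _ = η := ENNReal.add_halves η

theorem exists_finset_volume_image_le {S : Set (Set ℂ)} (hS : S.Countable)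
    (hsum : ∑' Q : ↥S, ediam (Q : Set ℂ) < ⊤) {η : ℝ≥0∞} (hη : η ≠ 0) :
    ∃ F : Finset ↥S, ∀ f : ℂ →L[ℝ] ℝ, ‖f‖ ≤ 1 →
      volume (f '' ⋃ Q : ↥{Q : ↥S | Q ∉ F}, ((Q : ↥S) : Set ℂ)) ≤ η := by
  obtain ⟨F, hF⟩ := ((ENNReal.tendsto_tsum_compl_atTop_zero hsum.ne).eventually_le_const
    hη.bot_lt).exists
  refine ⟨F, fun f hf => le_trans ?_ hF⟩
  have := hS.to_subtype
  rw [image_iUnion]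
  refine (measure_iUnion_le _).trans (ENNReal.tsum_le_tsum fun Q => ?_)
  refine (Real.volume_le_diam _).trans ?_
  have hL : LipschitzWith 1 f := f.lipschitz.weaken hf
  simpa using hL.ediam_image_le ((Q : ↥S) : Set ℂ)

theorem singletonPart_eq (K : Set ℂ) :
    SingletonPart K = K \ ⋃ Q ∈ NondegComponents K, Q := by
  ext x
  simp only [SingletonPart, mem_ofPred_eq, Set.mem_sdiff, mem_iUnion, exists_prop, not_exists, not_and]
  refine and_congr_right fun hx => ⟨?_, fun h => ?_⟩
  · rintro h Q ⟨⟨y, -, rfl⟩, a, ha, b, hb, hab⟩ hxQ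
    rw [connectedComponentIn_eq hxQ, h] at ha hb
    exact hab (ha.trans hb.symm)
  · have hxx := mem_connectedComponentIn hx
    by_contra hne
    refine h _ ⟨⟨x, hx, rfl⟩, x, hxx, ?_⟩ hxx
    by_contra! H
    exact hne (Subset.antisymm (fun y hy => (H y hy).symm) (singleton_subset_iff.2 hxx))

theorem measurableSet_singletonPart {K : Set ℂ} (hK : IsClosed K)
    (hcount : (NondegComponents K).Countable) : MeasurableSet (SingletonPart K) := by
  rw [singletonPart_eq]
  refine hK.measurableSet.diff (MeasurableSet.biUnion hcount ?_)
  rintro _ ⟨⟨x, hx, rfl⟩, -⟩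
  rw [connectedComponentIn_eq_image hx]
  exact (hK.isClosedMap_subtype_val _ isClosed_connectedComponent).measurableSet

namespace BoundedConformalPair

variable {D Ω : Set ℂ} {φ ψ : ℂ → ℂ}

/-- The degenerate boundary components of the target that correspond to complementary disks of
the source. -/
def diskPoints (D Ω : Set ℂ) (φ : ℂ → ℂ) : Set ℂ :=
  {p | p ∈ SingletonPart (frontier Ω) ∧
    ∃ ξ ∉ D, p ∈ boundaryFiber D φ ξ ∧ connectedComponentIn Dᶜ ξ ≠ {ξ}}

theorem countable_diskPoints (hc : BoundedConformalPair D Ω φ ψ) (hD : IsCircleDomain D) :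
    (diskPoints D Ω φ).Countable := by
  refine PairwiseDisjoint.countable_of_isOpen
    (s := fun p => interior {ζ | ζ ∉ D ∧ p ∈ boundaryFiber D φ ζ}) ?_
    (fun p _ => isOpen_interior) ?_
  · intro p hp q hq hpq
    refine Disjoint.mono interior_subset interior_subset (disjoint_left.2 ?_)
    rintro ζ ⟨hζ, h1⟩ ⟨-, h2⟩
    have e := (hc.boundaryFiber_eq_component hD hζ h1).symm.trans
      (hc.boundaryFiber_eq_component hD hζ h2)
    rw [hp.1.2, hq.1.2] at e
    exact hpq (singleton_injective e)
  · rintro p ⟨-, ξ, hξ, hp, hne⟩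
    refine Nonempty.mono (s := interior (connectedComponentIn Dᶜ ξ)) (interior_mono ?_) ?_
    · intro ζ hζ
      have hζD : ζ ∉ D := connectedComponentIn_subset _ _ hζ
      exact ⟨hζD, by rwa [boundaryFiber_congr hζD hξ (connectedComponentIn_eq hζ).symm]⟩
    · rcases hD.component_cases hξ with h | ⟨c, r, hr, h⟩ | ⟨c, r, hr, h⟩
      · exact absurd h hne
      · rw [h]
        exact ⟨c, ball_subset_interior_closedBall (mem_ball_self hr)⟩
      · rw [h, interior_compl]
        refine nonempty_compl.2 fun h' => ?_
        exact NormedSpace.unbounded_univ ℂ ℂ (h' ▸ isBounded_ball.closure)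

theorem fiber_eq_of_mem_singletonPart (hc : BoundedConformalPair D Ω φ ψ) (hD : IsCircleDomain D)
    {ξ ξ' p : ℂ} (hp : p ∈ SingletonPart (frontier Ω) \ diskPoints D Ω φ) (hξ : ξ ∉ D)
    (hξ' : ξ' ∉ D) (h : p ∈ boundaryFiber D φ ξ) (h' : p ∈ boundaryFiber D φ ξ') : ξ = ξ' := by
  have h1 : connectedComponentIn Dᶜ ξ = {ξ} := by
    by_contra hne; exact hp.2 ⟨hp.1, ξ, hξ, h, hne⟩
  have := hc.component_eq_of_mem_boundaryFiber hD hξ hξ' h h'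
  rw [h1] at this
  have h2 : ξ' ∈ ({ξ} : Set ℂ) := this ▸ mem_connectedComponentIn hξ'
  exact h2.symm

theorem countable_circle_hausdorffMeasure_pos (hc : BoundedConformalPair D Ω φ ψ)
    (hD : IsCircleDomain D) (hcount : (NondegComponents (frontier Ω)).Countable)
    (hsing : SigmaFiniteH1 (SingletonPart (frontier Ω))) (z₀ : ℂ) :
    {r : ℝ | 0 < μH[1] (Prod.snd '' (graphClosure D φ ∩ Prod.fst ⁻¹' (sphere z₀ r ∩ frontier D)) ∩
      (SingletonPart (frontier Ω) \ diskPoints D Ω φ))}.Countable := by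
  set A : ℝ → Set ℂ := fun r => Prod.snd '' (graphClosure D φ ∩
    Prod.fst ⁻¹' (sphere z₀ r ∩ frontier D)) ∩ (SingletonPart (frontier Ω) \ diskPoints D Ω φ)
    with hA
  have hAm : ∀ r, MeasurableSet (A r) := by
    intro r
    refine MeasurableSet.inter (IsCompact.measurableSet ?_)
      ((measurableSet_singletonPart isClosed_frontier hcount).diff
        (hc.countable_diskPoints hD).measurableSet)
    exact (hc.isCompact_graphClosure.inter_right
      ((isClosed_sphere.inter isClosed_frontier).preimage continuous_fst)).image continuous_snd
  have hAd : Pairwise (Function.onFun Disjoint A) := by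
    intro r r' hrr
    refine disjoint_left.2 ?_
    rintro p ⟨⟨⟨ξ, _⟩, ⟨hR, hξr, hξ⟩, rfl⟩, hp⟩ ⟨⟨⟨ξ', _⟩, ⟨hR', hξr', hξ'⟩, rfl⟩, -⟩
    have : ξ = ξ' := hc.fiber_eq_of_mem_singletonPart hD hp (hD.notMem_of_frontier hξ)
      (hD.notMem_of_frontier hξ') (hc.mem_boundaryFiber_of_graph hR)
      (hc.mem_boundaryFiber_of_graph hR')
    subst this
    exact hrr ((mem_sphere.1 hξr).symm.trans (mem_sphere.1 hξr'))
  obtain ⟨E, hE, hEfin⟩ := hsing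
  have hn : ∀ n, {r : ℝ | 0 < (μH[1]).restrict (E n) (A r)}.Countable := by
    intro n
    have : IsFiniteMeasure ((μH[1] : Measure ℂ).restrict (E n)) := ⟨by simpa using hEfin n⟩
    exact Measure.countable_meas_pos_of_disjoint_iUnion hAm hAd
  refine (countable_iUnion hn).mono fun r hr => ?_
  by_contra H
  simp only [mem_iUnion, mem_ofPred_eq, not_exists, not_lt, nonpos_iff_eq_zero] at H
  refine (show (0 : ℝ≥0∞) < μH[1] (A r) from hr).ne' ?_
  refine measure_mono_null (t := ⋃ n, A r ∩ E n) ?_ (measure_iUnion_null fun n => ?_)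
  · rw [← inter_iUnion, hE]
    exact fun p hp => ⟨hp, hp.2.1⟩
  · rw [← Measure.restrict_apply (hAm r)]
    exact H n

theorem eventually_boundaryFiber_ne (hc : BoundedConformalPair D Ω φ ψ) (hD : IsCircleDomain D)
    {z₀ : ℂ} (Q : Set ℂ) : ∀ᶠ r in 𝓝 (0 : ℝ), ∀ ξ ∈ sphere z₀ r \ connectedComponentIn Dᶜ z₀,
      ξ ∉ D → boundaryFiber D φ ξ ≠ Q := by
  by_cases hex : ∃ ξ₁ ∉ connectedComponentIn Dᶜ z₀, ξ₁ ∉ D ∧ boundaryFiber D φ ξ₁ = Q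
  · obtain ⟨ξ₁, hξ₁, hξ₁D, rfl⟩ := hex
    have hmem : (connectedComponentIn Dᶜ ξ₁)ᶜ ∈ 𝓝 z₀ := by
      refine (hD.isClosed_component hξ₁D).isOpen_compl.mem_nhds fun h => hξ₁ ?_
      rw [← connectedComponentIn_eq h]
      exact mem_connectedComponentIn hξ₁D
    obtain ⟨δ, hδ, hball⟩ := Metric.mem_nhds_iff.1 hmem
    filter_upwards [Iio_mem_nhds hδ] with r hr ξ hξ hξD heq
    obtain ⟨p, hp⟩ := hc.boundaryFiber_nonempty hD ξ
    have hcomp := hc.component_eq_of_mem_boundaryFiber hD hξD hξ₁D hp (heq ▸ hp)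
    refine hball (show ξ ∈ ball z₀ δ from ?_) (hcomp ▸ mem_connectedComponentIn hξD)
    rw [mem_ball, mem_sphere.1 hξ.1]; exact hr
  · exact Eventually.of_forall fun r ξ hξ hξD heq => hex ⟨ξ, hξ.2, hξD, heq⟩

theorem exists_small_circleFiber (hc : BoundedConformalPair D Ω φ ψ) (hD : IsCircleDomain D)
    (hcount : (NondegComponents (frontier Ω)).Countable)
    (hdiam : ∑' Q : ↥(NondegComponents (frontier Ω)), ediam (Q : Set ℂ) < ⊤)
    (hsing : SigmaFiniteH1 (SingletonPart (frontier Ω))) {z₀ : ℂ} (hz₀ : z₀ ∈ frontier D)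
    {η δ : ℝ} (hη : 0 < η) (hδ : 0 < δ) :
    ∃ r > 0, r < δ ∧ ∀ p ∈ circleFiber D φ z₀ r, ∀ q ∈ circleFiber D φ z₀ r, dist p q ≤ η := by
  have hη4 : ENNReal.ofReal (η / 4) ≠ 0 := by simpa using hη
  obtain ⟨F, hF⟩ := exists_finset_volume_image_le hcount hdiam hη4
  have hev : ∀ᶠ r in 𝓝 (0 : ℝ), ∀ Q ∈ F, ∀ ξ ∈ sphere z₀ r \ connectedComponentIn Dᶜ z₀,
      ξ ∉ D → boundaryFiber D φ ξ ≠ Q :=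
    (Filter.eventually_all_finset F).2 fun Q _ => hc.eventually_boundaryFiber_ne hD Q
  obtain ⟨δ', hδ', hball⟩ := Metric.eventually_nhds_iff.1 hev
  have hvol : volume (φ '' D) ≠ ⊤ := by
    rw [hc.map.2.image_eq]
    exact hc.target_bdd.measure_lt_top.ne
  obtain ⟨r, hr, hrN, hL⟩ := exists_small_volume_image_circle hc.isOpen_source hc.map.1
    hc.map.2.injOn hvol z₀ (hc.countable_circle_hausdorffMeasure_pos hD hcount hsing z₀)
    (lt_min hδ hδ') hη4
  simp only [mem_ofPred_eq, not_lt, nonpos_iff_eq_zero] at hrN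
  refine ⟨r, hr.1, hr.2.trans_le (min_le_left _ _), ?_⟩
  have hcov : circleFiber D φ z₀ r ⊆ φ '' (D ∩ sphere z₀ r) ∪
      (⋃ Q : ↥{Q : ↥(NondegComponents (frontier Ω)) | Q ∉ F}, ((Q : ↥(NondegComponents (frontier Ω))) : Set ℂ)) ∪
      (diskPoints D Ω φ ∪ (Prod.snd '' (graphClosure D φ ∩
        Prod.fst ⁻¹' (sphere z₀ r ∩ frontier D)) ∩
        (SingletonPart (frontier Ω) \ diskPoints D Ω φ))) := by
    intro p hp
    simp only [circleFiber, mem_iUnion, exists_prop] at hp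
    obtain ⟨ξ, hξ, hp⟩ := hp
    by_cases hξD : ξ ∈ D
    · rw [boundaryFiber_of_mem hξD, mem_singleton_iff] at hp
      exact Or.inl (Or.inl ⟨ξ, ⟨hξD, hξ.1⟩, hp.symm⟩)
    have hpf := hc.mem_frontier_of_mem_boundaryFiber hξD hp
    by_cases hps : p ∈ SingletonPart (frontier Ω)
    · by_cases hpd : p ∈ diskPoints D Ω φ
      · exact Or.inr (Or.inl hpd)
      · refine Or.inr (Or.inr ⟨?_, hps, hpd⟩)
        obtain ⟨z, hz, -, hR⟩ := (mem_boundaryFiber_of_notMem hξD).1 hp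
        have : z = ξ := hc.fiber_eq_of_mem_singletonPart hD ⟨hps, hpd⟩
          (hD.notMem_of_frontier hz) hξD (hc.mem_boundaryFiber_of_graph hR) hp
        subst this
        exact ⟨(z, p), ⟨hR, hξ.1, hz⟩, rfl⟩
    · refine Or.inl (Or.inr ?_)
      rw [singletonPart_eq] at hps
      simp only [Set.mem_sdiff, hpf, true_and, not_not, mem_iUnion, exists_prop] at hps
      obtain ⟨Q, hQ, hpQ⟩ := hps
      refine mem_iUnion.2 ⟨⟨⟨Q, hQ⟩, fun hQF => ?_⟩, hpQ⟩
      have hr' : dist r 0 < δ' := by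
        rw [Real.dist_0_eq_abs, abs_of_pos hr.1]
        exact hr.2.trans_le (min_le_right _ _)
      refine hball hr' _ hQF ξ hξ hξD ?_
      obtain ⟨⟨x, -, rfl⟩, -⟩ := hQ
      rw [hc.boundaryFiber_eq_component hD hξD hp, ← connectedComponentIn_eq hpQ]
  have hbound : ∀ f : ℂ →L[ℝ] ℝ, ‖f‖ ≤ 1 → ∀ p ∈ circleFiber D φ z₀ r,
      ∀ q ∈ circleFiber D φ z₀ r, dist (f p) (f q) ≤ η / 2 := by
    intro f hf p hp q hq
    have hLip : LipschitzWith 1 f := f.lipschitz.weaken hf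
    have h1 := ((hc.isPreconnected_circleFiber hD hz₀ hr.1).image f
      f.continuous.continuousOn).diam_le_of_mem (mem_image_of_mem f hp) (mem_image_of_mem f hq)
    have h2 : volume (f '' circleFiber D φ z₀ r) ≤ ENNReal.ofReal (η / 4) +
        ENNReal.ofReal (η / 4) + (0 + 0) := by
      refine (measure_mono (image_mono hcov)).trans ?_
      rw [image_union, image_union, image_union]
      refine (measure_union_le _ _).trans (add_le_add ((measure_union_le _ _).trans
        (add_le_add (hL f hf) (hF f hf))) ((measure_union_le _ _).trans (add_le_add ?_ ?_)))
      · exact (((hc.countable_diskPoints hD).image f).measure_zero volume).le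
      · rw [← hausdorffMeasure_real]
        refine (hLip.hausdorffMeasure_image_le zero_le_one _).trans ?_
        rw [hrN, mul_zero]
    have h3 := h1.trans h2
    rw [add_zero, add_zero, ← ENNReal.ofReal_add (by positivity) (by positivity),
      ENNReal.ofReal_le_ofReal_iff (by positivity)] at h3
    linarith
  intro p hp q hq
  have hre := hbound Complex.reCLM Complex.reCLM_norm.le p hp q hq
  have him := hbound Complex.imCLM Complex.imCLM_norm.le p hp q hq
  rw [Complex.dist_eq]
  refine (Complex.norm_le_abs_re_add_abs_im _).trans ?_
  simp only [Real.dist_eq, Complex.reCLM_apply, Complex.imCLM_apply, Complex.sub_re,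
    Complex.sub_im] at hre him ⊢
  linarith

end BoundedConformalPair

/-- First generalization of Carathéodory's continuity theorem. -/
theorem stmt_3 (D Ω : Set ℂ) (φ : ℂ → ℂ)
    (hΩ : IsPlanarDomain Ω) (hΩb : Bornology.IsBounded Ω)
    (hcount : (NondegComponents (frontier Ω)).Countable)
    (hdiam : ∑' Q : ↥(NondegComponents (frontier Ω)), EMetric.diam (Q : Set ℂ) < ⊤)
    (hsing : SigmaFiniteH1 (SingletonPart (frontier Ω)))
    (hD : IsCircleDomain D)
    (hφ : IsConformalHomeoOnto φ D Ω) :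
    (∃ φb : ℂ → ℂ, ExtendsContinuously φ φb D Ω) ↔ IsPeanoCompactum (frontier Ω) := by
  obtain ⟨ψ, hψ, hinv⟩ := hφ.exists_inverse hD.isOpen
  have hc : BoundedConformalPair D Ω φ ψ := ⟨hD.1, hD.2.1, hΩ, hΩb, hφ, hψ, hinv⟩
  constructor
  · rintro ⟨φb, hcont, heq, -⟩
    exact hc.isPeanoCompactum_of_extends hD hdiam hcont heq
  · intro hP
    exact hc.exists_extension fun z₀ hz₀ => hc.tendsto_of_small_circleFiber hD hP.2.1 hz₀
      fun η hη δ hδ => hc.exists_small_circleFiber hD hcount hdiam hsing hz₀ hη hδ
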